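/- arXiv:1910.08744 — 8 statements merged into one kernel-verified Lean document; each statement's English description precedes it below -/
import Mathlib

section
/- Under Assumptions A1 and A2, the supremum sup_{Q ∈ Q̃} ∫ℝ c dQ(c) is finite and equals the optimal value of the finite-dimensional linear program: maximize ∑_{j=1}^{W} U_j δ_j over δ ∈ ℝ^W subject to δ_j ≥ 0 for all j ∈ {1,…,W}, ∑_{j=1}^{W} δ_j = 1, and q̲_i ≤ ∑_{j ∈ W(i)} δ_j ≤ q̄_i for every i ∈ {1,…,D}; moreover this linear program is feasible and its maximum is attained. -/
open MeasureTheory Set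
open scoped Classical

noncomputable section

/-- The quantile ambiguity set `Q̃`: Borel probability measures on `ℝ` whose probability of each
baseline subinterval `[lo i, hi i]` lies between `ql i` and `qh i`. -/
def ambSet (D : ℕ) (lo hi ql qh : Fin D → ℝ) : Set (Measure ℝ) :=
  {Q | IsProbabilityMeasure Q ∧ ∀ i : Fin D,
    ql i ≤ (Q (Icc (lo i) (hi i))).toReal ∧ (Q (Icc (lo i) (hi i))).toReal ≤ qh i}

/-- Feasibility for the primal linear program over elementary subintervals:
`δ ≥ 0`, `∑ δ_j = 1`, and `q̲_i ≤ ∑_{j ∈ W(i)} δ_j ≤ q̄_i` for every `i`. -/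
def lpFeas (D W : ℕ) (lo hi ql qh : Fin D → ℝ) (e : Fin (W + 1) → ℝ) (δ : Fin W → ℝ) : Prop :=
  (∀ j, 0 ≤ δ j) ∧ (∑ j, δ j) = 1 ∧
    ∀ i : Fin D,
      ql i ≤ (∑ j ∈ Finset.univ.filter
          (fun j : Fin W => Icc (e j.castSucc) (e j.succ) ⊆ Icc (lo i) (hi i)), δ j) ∧
      (∑ j ∈ Finset.univ.filter
          (fun j : Fin W => Icc (e j.castSucc) (e j.succ) ⊆ Icc (lo i) (hi i)), δ j) ≤ qh i

/-- Every point of `[e 0, e W)` lies in a half-open cell `[e j, e (j + 1))`. -/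
theorem exists_castSucc_le_lt_succ {W : ℕ} (e : Fin (W + 1) → ℝ) {x : ℝ} (h0 : e 0 ≤ x)
    (h1 : x < e (Fin.last W)) : ∃ j : Fin W, e j.castSucc ≤ x ∧ x < e j.succ := by
  by_contra! h
  have key : ∀ k, e k ≤ x := fun k => by
    induction k using Fin.induction with
    | zero => exact h0
    | succ j ih => exact h j ih
  exact absurd (key (Fin.last W)) (not_le.2 h1)

/-- Every point of `(e 0, e W]` lies in a half-open cell `(e j, e (j + 1)]`. -/
theorem exists_castSucc_lt_le_succ {W : ℕ} (e : Fin (W + 1) → ℝ) {x : ℝ} (h0 : e 0 < x)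
    (h1 : x ≤ e (Fin.last W)) : ∃ j : Fin W, e j.castSucc < x ∧ x ≤ e j.succ := by
  by_contra! h
  have key : ∀ k, e k < x := fun k => by
    induction k using Fin.induction with
    | zero => exact h0
    | succ j ih => exact h j ih
  exact absurd (key (Fin.last W)) (not_lt.2 h1)

theorem StrictMono.succ_le_of_castSucc_lt {W : ℕ} {e : Fin (W + 1) → ℝ} (he : StrictMono e)
    {j : Fin W} {y : ℝ} (hy : y ∈ range e) (h : e j.castSucc < y) : e j.succ ≤ y := by
  obtain ⟨m, rfl⟩ := hy
  exact he.monotone (Fin.castSucc_lt_iff_succ_le.1 (he.lt_iff_lt.1 h))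

theorem StrictMono.le_castSucc_of_lt_succ {W : ℕ} {e : Fin (W + 1) → ℝ} (he : StrictMono e)
    {j : Fin W} {y : ℝ} (hy : y ∈ range e) (h : y < e j.succ) : y ≤ e j.castSucc := by
  by_contra! h'
  exact absurd (he.succ_le_of_castSucc_lt hy h') (not_le.2 h)

/-- The points of the `j`-th elementary interval that belong to exactly those baseline intervals
which contain the whole elementary interval. -/
def elemCell {D W : ℕ} (lo hi : Fin D → ℝ) (e : Fin (W + 1) → ℝ) (j : Fin W) : Set ℝ :=
  {x | x ∈ Icc (e j.castSucc) (e j.succ) ∧ ∀ i, x ∈ Icc (lo i) (hi i) ↔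
    Icc (e j.castSucc) (e j.succ) ⊆ Icc (lo i) (hi i)}

section Cells

variable {D W : ℕ} {lo hi : Fin D → ℝ} {e : Fin (W + 1) → ℝ}

theorem measurableSet_elemCell (j : Fin W) : MeasurableSet (elemCell lo hi e j) := by
  have : elemCell lo hi e j = Icc (e j.castSucc) (e j.succ) ∩ ⋂ i, {x | x ∈ Icc (lo i) (hi i) ↔
      Icc (e j.castSucc) (e j.succ) ⊆ Icc (lo i) (hi i)} := by
    ext x; simp [elemCell]
  rw [this]
  exact measurableSet_Icc.inter (MeasurableSet.iInter fun i =>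
    MeasurableSet.iff measurableSet_Icc (MeasurableSet.const _))

theorem Icc_castSucc_succ_subset_iff (hemono : StrictMono e) (j : Fin W) (a b : ℝ) :
    Icc (e j.castSucc) (e j.succ) ⊆ Icc a b ↔ a ≤ e j.castSucc ∧ e j.succ ≤ b :=
  Icc_subset_Icc_iff (hemono.monotone j.castSucc_lt_succ.le)

theorem pairwise_disjoint_elemCell (hlohi : ∀ i, lo i ≤ hi i) (hemono : StrictMono e)
    (herange : range e = range lo ∪ range hi) :
    Pairwise (Function.onFun Disjoint (elemCell lo hi e)) := by
  refine (pairwise_disjoint_on _).2 fun j k hjk => Set.disjoint_left.2 ?_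
  rintro x ⟨hxj, hj⟩ ⟨hxk, hk⟩
  have hle : e j.succ ≤ e k.castSucc := hemono.monotone (Fin.succ_le_castSucc_iff.2 hjk)
  have hx1 : x = e j.succ := le_antisymm hxj.2 (hle.trans hxk.1)
  have hx2 : x = e k.castSucc := le_antisymm (hxj.2.trans hle) hxk.1
  have hltj : e j.castSucc < e j.succ := hemono j.castSucc_lt_succ
  have hltk : e k.castSucc < e k.succ := hemono k.castSucc_lt_succ
  have hmem : x ∈ range lo ∪ range hi := herange ▸ ⟨_, hx1.symm⟩
  rcases hmem with ⟨i, rfl⟩ | ⟨i, rfl⟩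
  · have := (Icc_castSucc_succ_subset_iff hemono j _ _).1 ((hj i).1 ⟨le_rfl, hlohi i⟩)
    linarith [this.1]
  · have := (Icc_castSucc_succ_subset_iff hemono k _ _).1 ((hk i).1 ⟨hlohi i, le_rfl⟩)
    linarith [this.2]

theorem exists_mem_elemCell (hemono : StrictMono e) (herange : range e = range lo ∪ range hi)
    (hA2 : ∀ i₁ i₂ : Fin D, lo i₁ ≠ hi i₂) (h0 : e 0 ∈ range lo)
    (h1 : e (Fin.last W) ∈ range hi) {x : ℝ} (hx : x ∈ Icc (e 0) (e (Fin.last W))) :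
    ∃ j, x ∈ elemCell lo hi e j := by
  have hlo : ∀ i, lo i ∈ range e := fun i => herange ▸ Or.inl ⟨i, rfl⟩
  have hhi : ∀ i, hi i ∈ range e := fun i => herange ▸ Or.inr ⟨i, rfl⟩
  by_cases hxr : x ∈ range hi
  · have hxl : x ∉ range lo := by
      rintro ⟨i, rfl⟩
      obtain ⟨i', h⟩ := hxr
      exact hA2 i i' h.symm
    obtain ⟨j, hj1, hj2⟩ := exists_castSucc_lt_le_succ e
      (lt_of_le_of_ne hx.1 fun h => hxl (h ▸ h0)) hx.2
    refine ⟨j, ⟨hj1.le, hj2⟩, fun i => ⟨fun h => ?_, fun h => h ⟨hj1.le, hj2⟩⟩⟩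
    rw [Icc_castSucc_succ_subset_iff hemono]
    have hne : lo i ≠ x := fun h => hxl ⟨i, h⟩
    exact ⟨hemono.le_castSucc_of_lt_succ (hlo i) ((lt_of_le_of_ne h.1 hne).trans_le hj2),
      hemono.succ_le_of_castSucc_lt (hhi i) (hj1.trans_le h.2)⟩
  · obtain ⟨j, hj1, hj2⟩ := exists_castSucc_le_lt_succ e hx.1
      (lt_of_le_of_ne hx.2 fun h => hxr (h ▸ h1))
    refine ⟨j, ⟨hj1, hj2.le⟩, fun i => ⟨fun h => ?_, fun h => h ⟨hj1, hj2.le⟩⟩⟩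
    rw [Icc_castSucc_succ_subset_iff hemono]
    have hne : x ≠ hi i := fun h => hxr ⟨i, h.symm⟩
    exact ⟨hemono.le_castSucc_of_lt_succ (hlo i) (h.1.trans_lt hj2),
      hemono.succ_le_of_castSucc_lt (hhi i) (hj1.trans_lt (lt_of_le_of_ne h.2 hne))⟩

/-- Pushing the mass of each cell to its right endpoint turns a measure of the ambiguity set into
a feasible point of the linear program with an objective at least as large. -/
theorem exists_lpFeas_of_mem_ambSet {ql qh : Fin D → ℝ} (hlohi : ∀ i, lo i ≤ hi i)
    (hemono : StrictMono e) (herange : range e = range lo ∪ range hi)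
    (hA2 : ∀ i₁ i₂ : Fin D, lo i₁ ≠ hi i₂) {d : Fin D} (hlod : lo d = e 0)
    (hhid : hi d = e (Fin.last W)) (hqld : ql d = 1)
    {Q : Measure ℝ} (hQ : Q ∈ ambSet D lo hi ql qh) :
    ∃ δ : Fin W → ℝ, lpFeas D W lo hi ql qh e δ ∧ ∫ x, x ∂Q ≤ ∑ j, e j.succ * δ j := by
  obtain ⟨hprob, hQ⟩ := hQ
  have hdisj := pairwise_disjoint_elemCell hlohi hemono herange
  have hcover : ∀ x ∈ Icc (e 0) (e (Fin.last W)), ∃ j, x ∈ elemCell lo hi e j := fun x hx =>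
    exists_mem_elemCell hemono herange hA2 ⟨d, hlod⟩ ⟨d, hhid⟩ hx
  have hsub : ∀ j, elemCell lo hi e j ⊆ Icc (e 0) (e (Fin.last W)) := fun j x hx =>
    ⟨(hemono.monotone (Fin.zero_le _)).trans hx.1.1, hx.1.2.trans (hemono.monotone (Fin.le_last _))⟩
  have hunion : ⋃ j, elemCell lo hi e j = Icc (e 0) (e (Fin.last W)) :=
    Subset.antisymm (iUnion_subset hsub) fun x hx => mem_iUnion.2 (hcover x hx)
  have hfull : Q.real (Icc (e 0) (e (Fin.last W))) = 1 := by
    refine le_antisymm measureReal_le_one ?_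
    have := (hQ d).1
    rwa [hqld, hlod, hhid] at this
  have hsum : ∀ s : Finset (Fin W),
      ∑ j ∈ s, Q.real (elemCell lo hi e j) = Q.real (⋃ j ∈ s, elemCell lo hi e j) := fun s =>
    (measureReal_biUnion_finset (fun _ _ _ _ h => hdisj h)
      fun j _ => measurableSet_elemCell j).symm
  refine ⟨fun j => Q.real (elemCell lo hi e j), ⟨fun j => measureReal_nonneg, ?_, fun i => ?_⟩, ?_⟩
  · rw [hsum]
    simpa [hunion] using hfull
  · have hunion_i : ⋃ j ∈ Finset.univ.filter
        (fun j : Fin W => Icc (e j.castSucc) (e j.succ) ⊆ Icc (lo i) (hi i)),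
        elemCell lo hi e j = Icc (lo i) (hi i) := by
      ext x
      simp only [Finset.mem_filter, Finset.mem_univ, true_and, mem_iUnion, exists_prop]
      constructor
      · rintro ⟨j, hj, hx⟩
        exact hj hx.1
      · intro hx
        have hbd : ∀ y ∈ range e, y ∈ Icc (e 0) (e (Fin.last W)) := by
          rintro _ ⟨m, rfl⟩
          exact ⟨hemono.monotone (Fin.zero_le _), hemono.monotone (Fin.le_last _)⟩
        obtain ⟨j, hj⟩ := hcover x
          ⟨(hbd _ (herange ▸ Or.inl ⟨i, rfl⟩)).1.trans hx.1,
            hx.2.trans (hbd _ (herange ▸ Or.inr ⟨i, rfl⟩)).2⟩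
        exact ⟨j, (hj.2 i).1 hx, hj⟩
    rw [hsum, hunion_i]
    exact hQ i
  · have hae : ∀ᵐ x ∂Q, x ∈ Icc (e 0) (e (Fin.last W)) :=
      (mem_ae_iff_prob_eq_one measurableSet_Icc).2
        (by rw [← ofReal_measureReal, hfull, ENNReal.ofReal_one])
    have hint : ∀ j, IntegrableOn (fun x : ℝ => x) (elemCell lo hi e j) Q := fun j =>
      (continuous_id.continuousOn.integrableOn_compact
        (isCompact_Icc (a := e 0) (b := e (Fin.last W)))).mono_set (hsub j)
    calc ∫ x, x ∂Q = ∫ x in ⋃ j, elemCell lo hi e j, x ∂Q := by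
          rw [hunion, Measure.restrict_eq_self_of_ae_mem hae]
      _ = ∑ j, ∫ x in elemCell lo hi e j, x ∂Q :=
          integral_iUnion_fintype (fun j => measurableSet_elemCell j) hdisj hint
      _ ≤ ∑ j, e j.succ * Q.real (elemCell lo hi e j) := by
          refine Finset.sum_le_sum fun j _ => ?_
          calc ∫ x in elemCell lo hi e j, x ∂Q ≤ ∫ _ in elemCell lo hi e j, e j.succ ∂Q :=
                setIntegral_mono_on (hint j) (integrable_const _) (measurableSet_elemCell j)
                  fun x hx => hx.1.2
            _ = e j.succ * Q.real (elemCell lo hi e j) := by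
                rw [setIntegral_const, smul_eq_mul, mul_comm]

/-- Placing the masses of a feasible point of the linear program at interior points of the
elementary intervals gives a measure of the ambiguity set. -/
theorem exists_mem_ambSet_of_lpFeas {ql qh : Fin D → ℝ}
    (hemono : StrictMono e) (herange : range e = range lo ∪ range hi)
    {δ : Fin W → ℝ} (hδ : lpFeas D W lo hi ql qh e δ) (x : Fin W → ℝ)
    (hx : ∀ j, x j ∈ Ioo (e j.castSucc) (e j.succ)) :
    ∃ Q ∈ ambSet D lo hi ql qh, ∫ y, y ∂Q = ∑ j, x j * δ j := by
  obtain ⟨h0, h1, h⟩ := hδ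
  have hval : ∀ s, MeasurableSet s → (∑ j, ENNReal.ofReal (δ j) • Measure.dirac (x j)) s =
      ENNReal.ofReal (∑ j ∈ Finset.univ.filter (fun j => x j ∈ s), δ j) := by
    intro s hs
    rw [ENNReal.ofReal_sum_of_nonneg fun j _ => h0 j, Finset.sum_filter,
      Measure.finsetSum_apply]
    refine Finset.sum_congr rfl fun j _ => ?_
    by_cases hj : x j ∈ s <;> simp [Measure.dirac_apply' _ hs, hj]
  refine ⟨∑ j, ENNReal.ofReal (δ j) • Measure.dirac (x j), ⟨⟨?_⟩, fun i => ?_⟩, ?_⟩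
  · simp [hval _ MeasurableSet.univ, h1]
  · have hmem : ∀ j, x j ∈ Icc (lo i) (hi i) ↔
        Icc (e j.castSucc) (e j.succ) ⊆ Icc (lo i) (hi i) := fun j => by
      refine ⟨fun hj => ?_, fun hj => hj (Ioo_subset_Icc_self (hx j))⟩
      rw [Icc_castSucc_succ_subset_iff hemono]
      exact ⟨hemono.le_castSucc_of_lt_succ (herange ▸ Or.inl ⟨i, rfl⟩) (hj.1.trans_lt (hx j).2),
        hemono.succ_le_of_castSucc_lt (herange ▸ Or.inr ⟨i, rfl⟩) ((hx j).1.trans_le hj.2)⟩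
    rw [hval _ measurableSet_Icc, ENNReal.toReal_ofReal (Finset.sum_nonneg fun j _ => h0 j)]
    simp only [hmem]
    exact h i
  · rw [integral_finsetSum_measure fun j _ =>
      (integrable_dirac (by simp)).smul_measure ENNReal.ofReal_ne_top]
    refine Finset.sum_congr rfl fun j _ => ?_
    rw [integral_smul_measure, integral_dirac, ENNReal.toReal_ofReal (h0 j), smul_eq_mul, mul_comm]

theorem isCompact_setOf_lpFeas (ql qh : Fin D → ℝ) :
    IsCompact {δ : Fin W → ℝ | lpFeas D W lo hi ql qh e δ} := by
  refine (isCompact_Icc (a := (0 : Fin W → ℝ)) (b := 1)).of_isClosed_subset ?_ ?_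
  · simp only [lpFeas, ofPred_and, ofPred_forall]
    refine (isClosed_iInter fun j => isClosed_le (by fun_prop) (by fun_prop)).inter
      ((isClosed_eq (by fun_prop) (by fun_prop)).inter (isClosed_iInter fun i =>
        (isClosed_le (by fun_prop) (by fun_prop)).inter (isClosed_le (by fun_prop) (by fun_prop))))
  · rintro δ ⟨h0, h1, -⟩
    exact ⟨h0, fun j => (Finset.single_le_sum (fun k _ => h0 k) (Finset.mem_univ j)).trans h1.le⟩

end Cells

/-- Under Assumptions A1 and A2, `sup_{Q ∈ Q̃} ∫ c dQ` is finite and equals the optimal value of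
the finite-dimensional linear program; moreover the LP is feasible and its maximum is attained. -/
theorem stmt_1 (D W : ℕ) (hD : 0 < D)
    (l u : ℝ) (hl0 : 0 ≤ l) (hlu : l ≤ u)
    (lo hi ql qh : Fin D → ℝ)
    (hllo : ∀ i, l ≤ lo i) (hlohi : ∀ i, lo i ≤ hi i) (hhiu : ∀ i, hi i ≤ u)
    (hql0 : ∀ i, 0 ≤ ql i) (hqlqh : ∀ i, ql i ≤ qh i) (hqh1 : ∀ i, qh i ≤ 1)
    (hloD : lo ⟨D - 1, Nat.sub_lt hD one_pos⟩ = l)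
    (hhiD : hi ⟨D - 1, Nat.sub_lt hD one_pos⟩ = u)
    (hqlD : ql ⟨D - 1, Nat.sub_lt hD one_pos⟩ = 1)
    (hqhD : qh ⟨D - 1, Nat.sub_lt hD one_pos⟩ = 1)
    (e : Fin (W + 1) → ℝ) (hemono : StrictMono e)
    (herange : Set.range e = Set.range lo ∪ Set.range hi)
    (hA1 : ∃ Q ∈ ambSet D lo hi ql qh, ∀ i : Fin D, ql i < qh i →
      ql i < (Q (Icc (lo i) (hi i))).toReal ∧ (Q (Icc (lo i) (hi i))).toReal < qh i)
    (hA2 : ∀ i₁ i₂ : Fin D, lo i₁ ≠ hi i₂) :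
    ((fun Q : Measure ℝ => ∫ x, x ∂Q) '' ambSet D lo hi ql qh).Nonempty ∧
    BddAbove ((fun Q : Measure ℝ => ∫ x, x ∂Q) '' ambSet D lo hi ql qh) ∧
    ∃ δ : Fin W → ℝ, lpFeas D W lo hi ql qh e δ ∧
      (∀ δ' : Fin W → ℝ, lpFeas D W lo hi ql qh e δ' →
        (∑ j, e j.succ * δ' j) ≤ ∑ j, e j.succ * δ j) ∧
      sSup ((fun Q : Measure ℝ => ∫ x, x ∂Q) '' ambSet D lo hi ql qh) =
        ∑ j, e j.succ * δ j := by
  have hbd : ∀ k, e k ∈ Icc l u := fun k => by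
    have : e k ∈ range lo ∪ range hi := herange ▸ mem_range_self k
    rcases this with ⟨i, h⟩ | ⟨i, h⟩ <;> rw [← h]
    · exact ⟨hllo i, (hlohi i).trans (hhiu i)⟩
    · exact ⟨(hllo i).trans (hlohi i), hhiu i⟩
  have he0 : e 0 = l := by
    obtain ⟨m, hm⟩ : l ∈ range e := herange ▸ Or.inl ⟨_, hloD⟩
    exact le_antisymm (hm ▸ hemono.monotone (Fin.zero_le _)) (hbd 0).1
  have heW : e (Fin.last W) = u := by
    obtain ⟨m, hm⟩ : u ∈ range e := herange ▸ Or.inr ⟨_, hhiD⟩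
    exact le_antisymm (hbd _).2 (hm ▸ hemono.monotone (Fin.le_last _))
  have hpush : ∀ Q ∈ ambSet D lo hi ql qh, ∃ δ : Fin W → ℝ,
      lpFeas D W lo hi ql qh e δ ∧ ∫ x, x ∂Q ≤ ∑ j, e j.succ * δ j := fun Q hQ =>
    exists_lpFeas_of_mem_ambSet hlohi hemono herange hA2 (hloD.trans he0.symm)
      (hhiD.trans heW.symm) hqlD hQ
  obtain ⟨Q₀, hQ₀, -⟩ := hA1
  obtain ⟨δ₀, hδ₀, -⟩ := hpush Q₀ hQ₀
  obtain ⟨δ, hδ, hmax⟩ := (isCompact_setOf_lpFeas ql qh).exists_isMaxOn ⟨δ₀, hδ₀⟩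
    (f := fun δ : Fin W → ℝ => ∑ j, e j.succ * δ j) (by fun_prop)
  have hub : ∀ y ∈ (fun Q : Measure ℝ => ∫ x, x ∂Q) '' ambSet D lo hi ql qh,
      y ≤ ∑ j, e j.succ * δ j := by
    rintro _ ⟨Q, hQ, rfl⟩
    obtain ⟨δ', hδ', hle⟩ := hpush Q hQ
    exact hle.trans (hmax hδ')
  have hbdd : BddAbove ((fun Q : Measure ℝ => ∫ x, x ∂Q) '' ambSet D lo hi ql qh) := ⟨_, hub⟩
  refine ⟨⟨_, Q₀, hQ₀, rfl⟩, hbdd, δ, hδ, fun δ' hδ' => hmax hδ',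
    le_antisymm (csSup_le ⟨_, Q₀, hQ₀, rfl⟩ hub) ?_⟩
  have hlim : Filter.Tendsto
      (fun t : ℝ => ∑ j, (e j.succ - t * (e j.succ - e j.castSucc)) * δ j)
      (nhdsWithin 0 (Ioi 0)) (nhds (∑ j, e j.succ * δ j)) := by
    have hc : Continuous
        fun t : ℝ => ∑ j, (e j.succ - t * (e j.succ - e j.castSucc)) * δ j := by fun_prop
    simpa using (hc.tendsto 0).mono_left nhdsWithin_le_nhds
  refine le_of_tendsto hlim ?_
  filter_upwards [Ioo_mem_nhdsGT (zero_lt_one' ℝ)] with t ht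
  obtain ⟨Q, hQ, hval⟩ := exists_mem_ambSet_of_lpFeas hemono herange hδ
    (fun j => e j.succ - t * (e j.succ - e j.castSucc)) fun j => by
      have hlt : 0 < e j.succ - e j.castSucc := sub_pos.2 (hemono j.castSucc_lt_succ)
      constructor <;> nlinarith [ht.1, ht.2, mul_pos ht.1 hlt]
  exact le_csSup hbdd ⟨Q, hQ, hval⟩
end
end

section
/- Under Assumptions A1 and A2, the supremum sup_{Q ∈ Q̃} ∫ℝ c dQ(c) equals the optimal value of the dual linear program: minimize ∑_{i=1}^{D} (q̄_i k_i − q̲_i h_i) over k, h ∈ ℝ^D subject to k_i ≥ 0 and h_i ≥ 0 for all i ∈ {1,…,D} and ∑_{i ∈ D(j)} (k_i − h_i) ≥ U_j for every j ∈ {1,…,W}; moreover this linear program is feasible and its minimum is attained. -/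
open MeasureTheory Set
open scoped Classical

noncomputable section

/-- Feasibility for the dual linear program: `k, h ≥ 0` and
`∑_{i ∈ D(j)} (k_i − h_i) ≥ U_j` for every elementary subinterval `j`. -/
def dualFeas (D W : ℕ) (lo hi : Fin D → ℝ) (e : Fin (W + 1) → ℝ) (k h : Fin D → ℝ) : Prop :=
  (∀ i, 0 ≤ k i) ∧ (∀ i, 0 ≤ h i) ∧
    ∀ j : Fin W,
      e j.succ ≤ ∑ i ∈ Finset.univ.filter
        (fun i : Fin D => Icc (e j.castSucc) (e j.succ) ⊆ Icc (lo i) (hi i)), (k i - h i)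

/-- The **Farkas lemma** for finitely many linear functionals on a real vector space. -/
theorem farkas_finset {V ι : Type*} [AddCommGroup V] [Module ℝ V] (s : Finset ι) :
    ∀ (A : ι → Module.Dual ℝ V) (b : Module.Dual ℝ V),
      (∀ x, (∀ i ∈ s, A i x ≤ 0) → b x ≤ 0) →
      ∃ c : ι → ℝ, (∀ i, 0 ≤ c i) ∧ ∀ x, b x = ∑ i ∈ s, c i * A i x := by
  induction s using Finset.induction_on with
  | empty =>
    intro A b hb
    refine ⟨0, fun _ => le_rfl, fun x => ?_⟩
    have h₁ := hb x (by simp)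
    have h₂ := hb (-x) (by simp)
    rw [map_neg] at h₂
    simp only [Finset.sum_empty]
    linarith
  | insert a s ha ih =>
    intro A b hb
    by_cases hs : ∀ x, (∀ i ∈ s, A i x ≤ 0) → b x ≤ 0
    · obtain ⟨c, hc, hcb⟩ := ih A b hs
      refine ⟨Function.update c a 0, fun i => ?_, fun x => ?_⟩
      · rcases eq_or_ne i a with rfl | hi
        · simp
        · simpa [hi] using hc i
      · rw [Finset.sum_insert ha, hcb x, Function.update_self, zero_mul, zero_add]
        refine Finset.sum_congr rfl fun i hi => ?_
        rw [Function.update_of_ne (ne_of_mem_of_not_mem hi ha)]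
    · push Not at hs
      obtain ⟨y, hy, hby⟩ := hs
      have hay : 0 < A a y := by
        by_contra! h
        exact absurd (hb y (by simpa using ⟨h, hy⟩)) (not_le.2 hby)
      set z : V := (A a y)⁻¹ • y with hz
      have haz : A a z = 1 := by simp [hz, hay.ne']
      have hAz : ∀ i ∈ s, A i z ≤ 0 := fun i hi => by
        simpa [hz] using mul_nonpos_of_nonneg_of_nonpos (inv_nonneg.2 hay.le) (hy i hi)
      have hbz : 0 ≤ b z := by
        simpa [hz] using mul_nonneg (inv_nonneg.2 hay.le) hby.le
      obtain ⟨c, hc, hcb⟩ := ih (fun i => A i - A i z • A a) (b - b z • A a) (by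
        intro x hx
        have := hb (x - A a x • z) (by
          intro i hi
          rcases Finset.mem_insert.1 hi with rfl | hi
          · simp [haz]
          · have := hx i hi
            simp only [LinearMap.sub_apply, LinearMap.smul_apply, smul_eq_mul, map_sub,
              map_smul] at this ⊢
            linarith)
        simp only [LinearMap.sub_apply, LinearMap.smul_apply, smul_eq_mul, map_sub,
          map_smul] at this ⊢
        linarith)
      refine ⟨Function.update c a (b z - ∑ i ∈ s, c i * A i z), fun i => ?_, fun x => ?_⟩
      · rcases eq_or_ne i a with rfl | hi
        · have : ∑ j ∈ s, c j * A j z ≤ 0 :=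
            Finset.sum_nonpos fun j hj => mul_nonpos_of_nonneg_of_nonpos (hc j) (hAz j hj)
          rw [Function.update_self]
          linarith
        · simpa [hi] using hc i
      · have h₁ := hcb x
        simp only [LinearMap.sub_apply, LinearMap.smul_apply, smul_eq_mul, mul_sub,
          Finset.sum_sub_distrib] at h₁
        have h₂ : ∑ i ∈ s, Function.update c a (b z - ∑ i ∈ s, c i * A i z) i * A i x =
            ∑ i ∈ s, c i * A i x := Finset.sum_congr rfl fun i hi => by
          rw [Function.update_of_ne (ne_of_mem_of_not_mem hi ha)]
        have h₃ : ∑ i ∈ s, c i * (A i z * A a x) = (∑ i ∈ s, c i * A i z) * A a x := by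
          rw [Finset.sum_mul]
          exact Finset.sum_congr rfl fun i _ => by ring
        rw [Finset.sum_insert ha, Function.update_self, h₂, sub_mul]
        linarith

/-- The intervals meeting the interior of an elementary subinterval are those containing it. -/
theorem elementary_subset_iff {D W : ℕ} {lo hi : Fin D → ℝ} {e : Fin (W + 1) → ℝ}
    (hemono : StrictMono e) (herange : range e = range lo ∪ range hi) {j : Fin W} {x : ℝ}
    (hx : x ∈ Ioo (e j.castSucc) (e j.succ)) (i : Fin D) :
    Icc (e j.castSucc) (e j.succ) ⊆ Icc (lo i) (hi i) ↔ x ∈ Icc (lo i) (hi i) := by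
  refine ⟨fun h => h ⟨hx.1.le, hx.2.le⟩, fun h => Icc_subset_Icc ?_ ?_⟩
  · obtain ⟨m, hm⟩ : lo i ∈ range e := herange ▸ Or.inl ⟨i, rfl⟩
    rw [← hm]
    have := hemono.lt_iff_lt.1 (hm.trans_le h.1 |>.trans_lt hx.2)
    exact hemono.monotone (Fin.le_castSucc_iff.2 this)
  · obtain ⟨m, hm⟩ : hi i ∈ range e := herange ▸ Or.inr ⟨i, rfl⟩
    rw [← hm]
    have := hemono.lt_iff_lt.1 (hx.1.trans_le (h.2.trans_eq hm.symm))
    exact hemono.monotone (Fin.castSucc_lt_iff_succ_le.1 this)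

/-- Every point covered by some interval lies in an elementary subinterval which is contained in
exactly the intervals containing the point. -/
theorem exists_elementary {D W : ℕ} {lo hi : Fin D → ℝ} {e : Fin (W + 1) → ℝ}
    (hlohi : ∀ i, lo i ≤ hi i)
    (hemono : StrictMono e) (herange : range e = range lo ∪ range hi)
    (hA2 : ∀ i₁ i₂ : Fin D, lo i₁ ≠ hi i₂) {x : ℝ} {i₀ : Fin D}
    (hx : x ∈ Icc (lo i₀) (hi i₀)) :
    ∃ j : Fin W, x ≤ e j.succ ∧
      ∀ i, Icc (e j.castSucc) (e j.succ) ⊆ Icc (lo i) (hi i) ↔ x ∈ Icc (lo i) (hi i) := by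
  have hlo : ∀ i, ∃ m, e m = lo i := fun i => by
    have : lo i ∈ range e := herange ▸ Or.inl ⟨i, rfl⟩
    exact this
  have hhi : ∀ i, ∃ m, e m = hi i := fun i => by
    have : hi i ∈ range e := herange ▸ Or.inr ⟨i, rfl⟩
    exact this
  by_cases hxhi : ∃ i, hi i = x
  · obtain ⟨i₁, rfl⟩ := hxhi
    obtain ⟨m, hm⟩ := hhi i₁
    have hm0 : m ≠ 0 := by
      rintro rfl
      obtain ⟨n, hn⟩ := hlo i₁
      have := hemono.monotone (Fin.zero_le n)
      exact hA2 i₁ i₁ (le_antisymm (hlohi i₁) (by rw [← hm, ← hn]; exact this))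
    obtain ⟨j, rfl⟩ := Fin.exists_succ_eq.2 hm0
    refine ⟨j, hm.ge, fun i => ⟨fun h => ?_, fun h => Icc_subset_Icc ?_ (hm.trans_le h.2)⟩⟩
    · rw [← hm]
      exact h (right_mem_Icc.2 (hemono.monotone j.castSucc_lt_succ.le))
    · obtain ⟨n, hn⟩ := hlo i
      have hlt : e n < e j.succ := by
        rw [hn, hm]
        exact lt_of_le_of_ne h.1 (hA2 _ _)
      rw [← hn]
      exact hemono.monotone (Fin.le_castSucc_iff.2 (hemono.lt_iff_lt.1 hlt))
  · obtain ⟨n₀, hn₀⟩ := hlo i₀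
    obtain ⟨m₀, hm₀⟩ := hhi i₀
    have hne : (Finset.univ.filter fun n => e n ≤ x).Nonempty :=
      ⟨n₀, by simpa [hn₀] using hx.1⟩
    obtain ⟨n, hn, hmax⟩ := Finset.exists_max_image _ id hne
    simp only [Finset.mem_filter, Finset.mem_univ, true_and, id] at hn hmax
    have hxlt : ∀ i, x ≤ hi i → x < hi i := fun i h =>
      lt_of_le_of_ne h fun h' => hxhi ⟨i, h'.symm⟩
    have hnl : n ≠ Fin.last W := by
      rintro rfl
      have := hemono.monotone (Fin.le_last m₀)
      linarith [hxlt i₀ hx.2]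
    obtain ⟨j, rfl⟩ := Fin.exists_castSucc_eq.2 hnl
    have hxj : x < e j.succ := by
      by_contra! h
      exact absurd (hmax _ h) (not_le.2 j.castSucc_lt_succ)
    refine ⟨j, hxj.le, fun i => ⟨fun h => h ⟨hn, hxj.le⟩, fun h => Icc_subset_Icc ?_ ?_⟩⟩
    · obtain ⟨m, hm⟩ := hlo i
      rw [← hm]
      exact hemono.monotone (hmax m (hm.trans_le h.1))
    · obtain ⟨m, hm⟩ := hhi i
      rw [← hm]
      have := hemono.lt_iff_lt.1 (hn.trans_lt ((hxlt i h.2).trans_eq hm.symm))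
      exact hemono.monotone (Fin.castSucc_lt_iff_succ_le.1 this)

/-- Weak duality between the ambiguity set and the dual linear program. -/
theorem integral_le_dual {D W : ℕ} {lo hi ql qh : Fin D → ℝ} {e : Fin (W + 1) → ℝ}
    (hlohi : ∀ i, lo i ≤ hi i)
    (hemono : StrictMono e) (herange : range e = range lo ∪ range hi)
    (hA2 : ∀ i₁ i₂ : Fin D, lo i₁ ≠ hi i₂) {i₀ : Fin D} (hi₀ : ql i₀ = 1)
    {Q : Measure ℝ} (hQ : Q ∈ ambSet D lo hi ql qh) {k h : Fin D → ℝ}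
    (hkh : dualFeas D W lo hi e k h) :
    ∫ x, x ∂Q ≤ ∑ i, (qh i * k i - ql i * h i) := by
  obtain ⟨hprob, hQ⟩ := hQ
  obtain ⟨hk, hh, hkh⟩ := hkh
  have hae : ∀ᵐ x ∂Q, x ∈ Icc (lo i₀) (hi i₀) := by
    refine (mem_ae_iff_prob_eq_one measurableSet_Icc).2 ?_
    have h₁ := (hQ i₀).1
    rw [hi₀] at h₁
    refine le_antisymm prob_le_one ?_
    exact (ENNReal.ofReal_one.ge.trans (ENNReal.ofReal_le_ofReal h₁)).trans
      ENNReal.ofReal_toReal_le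
  have hint : Integrable (fun x : ℝ => x) Q := by
    refine Integrable.of_bound (C := max |lo i₀| |hi i₀|) aestronglyMeasurable_id ?_
    filter_upwards [hae] with x hx
    exact abs_le_max_abs_abs hx.1 hx.2
  have hind : ∀ i ∈ Finset.univ, Integrable
      (fun x => (k i - h i) * (Icc (lo i) (hi i)).indicator (fun _ => (1 : ℝ)) x) Q :=
    fun i _ => ((integrable_const 1).indicator measurableSet_Icc).const_mul _
  calc ∫ x, x ∂Q
      ≤ ∫ x, ∑ i, (k i - h i) * (Icc (lo i) (hi i)).indicator (fun _ => (1 : ℝ)) x ∂Q := by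
        refine integral_mono_ae hint (integrable_finsetSum _ hind) ?_
        filter_upwards [hae] with x hx
        obtain ⟨j, hxj, hj⟩ := exists_elementary hlohi hemono herange hA2 hx
        refine hxj.trans ((hkh j).trans_eq ?_)
        rw [Finset.sum_filter]
        refine Finset.sum_congr rfl fun i _ => ?_
        simp only [hj i, indicator_apply]
        split_ifs <;> simp
    _ = ∑ i, (k i - h i) * (Q (Icc (lo i) (hi i))).toReal := by
        rw [integral_finsetSum _ hind]
        refine Finset.sum_congr rfl fun i _ => ?_
        rw [integral_const_mul, integral_indicator_const _ measurableSet_Icc]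
        simp [Measure.real]
    _ ≤ _ := by
        refine Finset.sum_le_sum fun i _ => ?_
        nlinarith [mul_le_mul_of_nonneg_left (hQ i).1 (hh i),
          mul_le_mul_of_nonneg_left (hQ i).2 (hk i)]

/-- A feasible point of the primal linear program is approximated by discrete measures in the
ambiguity set. -/
theorem primal_le_of_forall_integral_le {D W : ℕ} {lo hi ql qh : Fin D → ℝ}
    {e : Fin (W + 1) → ℝ} (hemono : StrictMono e) (herange : range e = range lo ∪ range hi)
    {v : ℝ} (hv : ∀ Q ∈ ambSet D lo hi ql qh, ∫ x, x ∂Q ≤ v)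
    {p : Fin W → ℝ} (hp : ∀ j, 0 ≤ p j) (hp1 : ∑ j, p j = 1)
    (hpq : ∀ i, ql i ≤ ∑ j, (if Icc (e j.castSucc) (e j.succ) ⊆ Icc (lo i) (hi i) then p j else 0)
      ∧ ∑ j, (if Icc (e j.castSucc) (e j.succ) ⊆ Icc (lo i) (hi i) then p j else 0) ≤ qh i) :
    ∑ j, e j.succ * p j ≤ v := by
  set y : ℝ → Fin W → ℝ := fun ε j => e j.succ - ε * (e j.succ - e j.castSucc) with hy
  have key : ∀ ε ∈ Ioo (0 : ℝ) 1, ∑ j, y ε j * p j ≤ v := by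
    rintro ε ⟨hε0, hε1⟩
    have hyI : ∀ j, y ε j ∈ Ioo (e j.castSucc) (e j.succ) := fun j => by
      have := hemono j.castSucc_lt_succ
      constructor <;> simp only [hy] <;> nlinarith
    set Q : Measure ℝ := ∑ j, ENNReal.ofReal (p j) • Measure.dirac (y ε j) with hQ
    have hQs : ∀ s, MeasurableSet s → Q s = ENNReal.ofReal (∑ j, if y ε j ∈ s then p j else 0) := by
      intro s hs
      rw [ENNReal.ofReal_sum_of_nonneg fun j _ => by split_ifs <;> simp [hp j]]
      simp only [hQ, Measure.finsetSum_apply, Measure.smul_apply, Measure.dirac_apply' _ hs,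
        smul_eq_mul, indicator_apply]
      refine Finset.sum_congr rfl fun j _ => ?_
      split_ifs <;> simp
    have hmem : Q ∈ ambSet D lo hi ql qh := by
      refine ⟨⟨by simp [hQs univ MeasurableSet.univ, hp1]⟩, fun i => ?_⟩
      rw [hQs _ measurableSet_Icc, ENNReal.toReal_ofReal
        (Finset.sum_nonneg fun j _ => by split_ifs <;> simp [hp j])]
      have := hpq i
      simp only [elementary_subset_iff hemono herange (hyI _) i] at this
      convert this
    have hint := hv Q hmem
    rw [hQ, integral_finsetSum_measure fun j _ =>
      (integrable_dirac (by simp)).smul_measure ENNReal.ofReal_ne_top] at hint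
    refine le_of_eq_of_le (Finset.sum_congr rfl fun j _ => ?_) hint
    rw [integral_smul_measure, integral_dirac, ENNReal.toReal_ofReal (hp j), smul_eq_mul, mul_comm]
  have hcont : Filter.Tendsto (fun ε => ∑ j, y ε j * p j) (nhdsWithin 0 (Ioi 0))
      (nhds (∑ j, y 0 j * p j)) := by
    refine (Continuous.tendsto ?_ 0).mono_left nhdsWithin_le_nhds
    fun_prop
  have hle := le_of_tendsto hcont (Filter.mem_of_superset (Ioo_mem_nhdsGT one_pos) key)
  simpa [hy] using hle

/-- Elementary subintervals are contained in an interval containing all the others. -/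
theorem elementary_subset_of_forall {D W : ℕ} {lo hi : Fin D → ℝ}
    {e : Fin (W + 1) → ℝ} (herange : range e = range lo ∪ range hi)
    {i₀ : Fin D} (hlo₀ : ∀ i, lo i₀ ≤ lo i) (hhi₀ : ∀ i, hi i ≤ hi i₀) (hlohi : ∀ i, lo i ≤ hi i)
    (j : Fin W) : Icc (e j.castSucc) (e j.succ) ⊆ Icc (lo i₀) (hi i₀) := by
  have he : ∀ m, e m ∈ Icc (lo i₀) (hi i₀) := fun m => by
    have : e m ∈ range lo ∪ range hi := herange ▸ mem_range_self m
    rcases this with ⟨i, hi'⟩ | ⟨i, hi'⟩ <;> rw [← hi']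
    · exact ⟨hlo₀ i, (hlohi i).trans (hhi₀ i)⟩
    · exact ⟨(hlo₀ i).trans (hlohi i), hhi₀ i⟩
  exact Icc_subset_Icc (he _).1 (he _).2

/-- The dual linear program is feasible. -/
theorem exists_dualFeas {D W : ℕ} {lo hi : Fin D → ℝ}
    {e : Fin (W + 1) → ℝ} (hemono : StrictMono e) (herange : range e = range lo ∪ range hi)
    {i₀ : Fin D} (hlo₀ : ∀ i, lo i₀ ≤ lo i) (hhi₀ : ∀ i, hi i ≤ hi i₀) (hlohi : ∀ i, lo i ≤ hi i) :
    ∃ k h : Fin D → ℝ, dualFeas D W lo hi e k h := by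
  refine ⟨Pi.single i₀ |hi i₀|, 0, fun i => ?_, fun i => le_rfl, fun j => ?_⟩
  · rcases eq_or_ne i i₀ with rfl | hi' <;> simp [*]
  · have hj := elementary_subset_of_forall herange hlo₀ hhi₀ hlohi j
    have hle := (hj (right_mem_Icc.2 (hemono.monotone j.castSucc_lt_succ.le))).2
    simpa [Finset.sum_filter, Pi.single_apply, hj] using hle.trans (le_abs_self _)

/-- Strong duality: an upper bound on the expectations over the ambiguity set is an upper bound on
the value of some dual feasible point. -/
theorem exists_dualFeas_le {D W : ℕ} {lo hi ql qh : Fin D → ℝ}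
    {e : Fin (W + 1) → ℝ} (hemono : StrictMono e) (herange : range e = range lo ∪ range hi)
    {i₀ : Fin D} (hlo₀ : ∀ i, lo i₀ ≤ lo i) (hhi₀ : ∀ i, hi i ≤ hi i₀) (hlohi : ∀ i, lo i ≤ hi i)
    (hql₀ : ql i₀ = 1) (hqh₀ : qh i₀ = 1)
    {v : ℝ} (hv : ∀ Q ∈ ambSet D lo hi ql qh, ∫ x, x ∂Q ≤ v) :
    ∃ k h : Fin D → ℝ, dualFeas D W lo hi e k h ∧ ∑ i, (qh i * k i - ql i * h i) ≤ v := by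
  set a : Fin D → Fin W → ℝ := fun i j =>
    if Icc (e j.castSucc) (e j.succ) ⊆ Icc (lo i) (hi i) then 1 else 0 with ha
  have ha₀ : ∀ j, a i₀ j = 1 := fun j => if_pos <|
    elementary_subset_of_forall herange hlo₀ hhi₀ hlohi j
  let t : Module.Dual ℝ ((Fin W → ℝ) × ℝ) := LinearMap.snd ℝ _ _
  let P : Fin W → Module.Dual ℝ ((Fin W → ℝ) × ℝ) := fun j =>
    LinearMap.proj j ∘ₗ LinearMap.fst ℝ _ _
  let A : Fin W ⊕ Fin D ⊕ Fin D ⊕ Unit → Module.Dual ℝ ((Fin W → ℝ) × ℝ) :=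
    Sum.elim (fun j => -P j) (Sum.elim (fun i => ∑ j, a i j • P j - qh i • t)
      (Sum.elim (fun i => ql i • t - ∑ j, a i j • P j) fun _ => -t))
  obtain ⟨c, hc, hcb⟩ := farkas_finset Finset.univ A (∑ j, e j.succ • P j - v • t) (by
    rintro ⟨p, τ⟩ hx
    have hp : ∀ j, 0 ≤ p j := fun j => by
      simpa [A, P] using hx (Sum.inl j) (Finset.mem_univ _)
    have hup : ∀ i, ∑ j, a i j * p j ≤ qh i * τ := fun i => by
      simpa [A, P, t] using hx (Sum.inr (Sum.inl i)) (Finset.mem_univ _)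
    have hdn : ∀ i, ql i * τ ≤ ∑ j, a i j * p j := fun i => by
      simpa [A, P, t] using hx (Sum.inr (Sum.inr (Sum.inl i))) (Finset.mem_univ _)
    have hτ : 0 ≤ τ := by
      simpa [A, t] using hx (Sum.inr (Sum.inr (Sum.inr ()))) (Finset.mem_univ _)
    have hsum : ∑ j, p j = τ := by
      have h₁ := hup i₀
      have h₂ := hdn i₀
      simp only [ha₀, hql₀, hqh₀, one_mul] at h₁ h₂
      exact le_antisymm h₁ h₂
    suffices ∑ j, e j.succ * p j ≤ v * τ by simpa [P, t] using this
    rcases hτ.eq_or_lt with rfl | hτ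
    · have hp0 : ∀ j, p j = 0 := fun j =>
        (Finset.sum_eq_zero_iff_of_nonneg fun j _ => hp j).1 hsum j (Finset.mem_univ j)
      simp [hp0]
    · have hscale : ∀ i, ∑ j, (if Icc (e j.castSucc) (e j.succ) ⊆ Icc (lo i) (hi i)
          then p j / τ else 0) = (∑ j, a i j * p j) / τ := fun i => by
        rw [Finset.sum_div]
        refine Finset.sum_congr rfl fun j _ => ?_
        simp only [ha]
        split_ifs <;> simp
      have := primal_le_of_forall_integral_le hemono herange hv (p := fun j => p j / τ)
        (fun j => div_nonneg (hp j) hτ.le) (by rw [← Finset.sum_div, hsum, div_self hτ.ne'])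
        (fun i => by
          rw [hscale, le_div_iff₀ hτ, div_le_iff₀ hτ]
          exact ⟨hdn i, hup i⟩)
      simp only [← mul_div_assoc, ← Finset.sum_div] at this
      exact (div_le_iff₀ hτ).1 this)
  refine ⟨fun i => c (Sum.inr (Sum.inl i)), fun i => c (Sum.inr (Sum.inr (Sum.inl i))),
    ⟨fun i => hc _, fun i => hc _, fun j => ?_⟩, ?_⟩
  · have h₁ := hcb (Pi.single j 1, 0)
    have h₂ := hc (Sum.inl j)
    simp [A, P, t, Pi.single_apply, Fintype.sum_sum_type] at h₁
    rw [Finset.sum_filter]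
    have h₃ : ∀ i, (if Icc (e j.castSucc) (e j.succ) ⊆ Icc (lo i) (hi i) then
        c (Sum.inr (Sum.inl i)) - c (Sum.inr (Sum.inr (Sum.inl i))) else 0) =
        c (Sum.inr (Sum.inl i)) * a i j - c (Sum.inr (Sum.inr (Sum.inl i))) * a i j := fun i => by
      simp only [ha]
      split_ifs <;> simp
    simp only [h₃, Finset.sum_sub_distrib]
    linarith
  · have h₁ := hcb (0, 1)
    have h₂ := hc (Sum.inr (Sum.inr (Sum.inr ())))
    simp [A, P, t, Fintype.sum_sum_type] at h₁
    simp only [Finset.sum_sub_distrib, mul_comm (qh _), mul_comm (ql _)]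
    linarith

/-- Under Assumptions A1 and A2, `sup_{Q ∈ Q̃} ∫ c dQ` equals the optimal value of the dual
linear program; moreover the dual LP is feasible and its minimum is attained. -/
theorem stmt_2 (D W : ℕ) (hD : 0 < D)
    (l u : ℝ) (hl0 : 0 ≤ l) (hlu : l ≤ u)
    (lo hi ql qh : Fin D → ℝ)
    (hllo : ∀ i, l ≤ lo i) (hlohi : ∀ i, lo i ≤ hi i) (hhiu : ∀ i, hi i ≤ u)
    (hql0 : ∀ i, 0 ≤ ql i) (hqlqh : ∀ i, ql i ≤ qh i) (hqh1 : ∀ i, qh i ≤ 1)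
    (hloD : lo ⟨D - 1, Nat.sub_lt hD one_pos⟩ = l)
    (hhiD : hi ⟨D - 1, Nat.sub_lt hD one_pos⟩ = u)
    (hqlD : ql ⟨D - 1, Nat.sub_lt hD one_pos⟩ = 1)
    (hqhD : qh ⟨D - 1, Nat.sub_lt hD one_pos⟩ = 1)
    (e : Fin (W + 1) → ℝ) (hemono : StrictMono e)
    (herange : Set.range e = Set.range lo ∪ Set.range hi)
    (hA1 : ∃ Q ∈ ambSet D lo hi ql qh, ∀ i : Fin D, ql i < qh i →
      ql i < (Q (Icc (lo i) (hi i))).toReal ∧ (Q (Icc (lo i) (hi i))).toReal < qh i)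
    (hA2 : ∀ i₁ i₂ : Fin D, lo i₁ ≠ hi i₂) :
    ∃ k h : Fin D → ℝ, dualFeas D W lo hi e k h ∧
      (∀ k' h' : Fin D → ℝ, dualFeas D W lo hi e k' h' →
        (∑ i, (qh i * k i - ql i * h i)) ≤ ∑ i, (qh i * k' i - ql i * h' i)) ∧
      sSup ((fun Q : Measure ℝ => ∫ x, x ∂Q) '' ambSet D lo hi ql qh) =
        ∑ i, (qh i * k i - ql i * h i) := by
  set d : Fin D := ⟨D - 1, Nat.sub_lt hD one_pos⟩
  obtain ⟨Q₀, hQ₀, -⟩ := hA1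
  have hweak : ∀ k h, dualFeas D W lo hi e k h → ∀ Q ∈ ambSet D lo hi ql qh,
      ∫ x, x ∂Q ≤ ∑ i, (qh i * k i - ql i * h i) := fun k h hkh Q hQ =>
    integral_le_dual hlohi hemono herange hA2 hqlD hQ hkh
  have hlo₀ : ∀ i, lo d ≤ lo i := fun i => hloD.trans_le (hllo i)
  have hhi₀ : ∀ i, hi i ≤ hi d := fun i => (hhiu i).trans_eq hhiD.symm
  set S := (fun Q : Measure ℝ => ∫ x, x ∂Q) '' ambSet D lo hi ql qh
  have hne : S.Nonempty := ⟨_, Q₀, hQ₀, rfl⟩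
  have hbdd : BddAbove S := by
    obtain ⟨k, h, hkh⟩ := exists_dualFeas (W := W) hemono herange hlo₀ hhi₀ hlohi
    refine ⟨∑ i, (qh i * k i - ql i * h i), ?_⟩
    rintro _ ⟨Q, hQ, rfl⟩
    exact hweak k h hkh Q hQ
  obtain ⟨k, h, hkh, hle⟩ := exists_dualFeas_le hemono herange hlo₀ hhi₀ hlohi hqlD hqhD
    (v := sSup S) fun Q hQ => le_csSup hbdd ⟨Q, hQ, rfl⟩
  have hsup : ∀ k' h', dualFeas D W lo hi e k' h' →
      sSup S ≤ ∑ i, (qh i * k' i - ql i * h' i) := fun k' h' hkh' => by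
    refine csSup_le hne ?_
    rintro _ ⟨Q, hQ, rfl⟩
    exact hweak k' h' hkh' Q hQ
  exact ⟨k, h, hkh, fun k' h' hkh' => hle.trans (hsup k' h' hkh'),
    le_antisymm (hsup k h hkh) hle⟩
end
end

section
/- Assume A2. Then for every c ∈ [l, u] there exists an index j ∈ {1,…,W} such that c ∈ [L_j, U_j] and the set of baseline subintervals containing c coincides with D(j), i.e. {i ∈ {1,…,D} : l_i ≤ c ≤ u_i} = D(j). -/
open Set
open scoped Classical

noncomputable section

/-- A real number with values of `e` on both sides is bracketed by two consecutive values. -/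
theorem exists_castSucc_le_lt_succ_s4 {W : ℕ} {e : Fin (W + 1) → ℝ} {c : ℝ} {a b : Fin (W + 1)}
    (he : Monotone e) (ha : e a ≤ c) (hb : c < e b) :
    ∃ j : Fin W, e j.castSucc ≤ c ∧ c < e j.succ := by
  obtain ⟨k, hk, hmax⟩ := Finset.exists_max_image
    (Finset.univ.filter fun k => e k ≤ c) id ⟨a, by simpa using ha⟩
  simp only [Finset.mem_filter, Finset.mem_univ, true_and, id_eq] at hk hmax
  have hkb : k < b := lt_of_not_ge fun h => absurd (he h) (by linarith)
  obtain ⟨j, rfl⟩ := Fin.exists_castSucc_eq.2 (hkb.trans_le (Fin.le_last b)).ne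
  exact ⟨j, hk, lt_of_not_ge fun h => absurd (hmax _ h) (not_le.2 j.castSucc_lt_succ)⟩

/-- Under Assumption A2, every `c ∈ [l, u]` lies in some elementary subinterval `[L_j, U_j]`
whose index set `D(j)` coincides with the set of baseline subintervals containing `c`. -/
theorem stmt_4 (D W : ℕ) (hD : 0 < D)
    (l u : ℝ) (hl0 : 0 ≤ l) (hlu : l ≤ u)
    (lo hi : Fin D → ℝ)
    (hllo : ∀ i, l ≤ lo i) (hlohi : ∀ i, lo i ≤ hi i) (hhiu : ∀ i, hi i ≤ u)
    (hloD : lo ⟨D - 1, Nat.sub_lt hD one_pos⟩ = l)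
    (hhiD : hi ⟨D - 1, Nat.sub_lt hD one_pos⟩ = u)
    (e : Fin (W + 1) → ℝ) (hemono : StrictMono e)
    (herange : Set.range e = Set.range lo ∪ Set.range hi)
    (hA2 : ∀ i₁ i₂ : Fin D, lo i₁ ≠ hi i₂) :
    ∀ c ∈ Icc l u, ∃ j : Fin W, c ∈ Icc (e j.castSucc) (e j.succ) ∧
      {i : Fin D | lo i ≤ c ∧ c ≤ hi i} =
        {i : Fin D | Icc (e j.castSucc) (e j.succ) ⊆ Icc (lo i) (hi i)} := by
  intro c ⟨hlc, hcu⟩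
  have hlo (i) : ∃ k, e k = lo i := by
    rw [← Set.mem_range, herange]; exact Or.inl ⟨i, rfl⟩
  have hhi (i) : ∃ k, e k = hi i := by
    rw [← Set.mem_range, herange]; exact Or.inr ⟨i, rfl⟩
  have lo_le (i) (j : Fin W) (h : lo i < e j.succ) : lo i ≤ e j.castSucc := by
    obtain ⟨k, hk⟩ := hlo i
    rw [← hk] at h ⊢
    exact hemono.monotone (Fin.le_castSucc_iff.2 (hemono.lt_iff_lt.1 h))
  have le_hi (i) (j : Fin W) (h : e j.castSucc < hi i) : e j.succ ≤ hi i := by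
    obtain ⟨k, hk⟩ := hhi i
    rw [← hk] at h ⊢
    exact hemono.monotone (Fin.castSucc_lt_iff_succ_le.1 (hemono.lt_iff_lt.1 h))
  suffices ∃ j : Fin W, c ∈ Icc (e j.castSucc) (e j.succ) ∧
      ∀ i, lo i ≤ c → c ≤ hi i → lo i ≤ e j.castSucc ∧ e j.succ ≤ hi i by
    obtain ⟨j, hc, hj⟩ := this
    refine ⟨j, hc, Set.ext fun i => ⟨fun h => ?_, fun h => h hc⟩⟩
    exact Icc_subset_Icc (hj i h.1 h.2).1 (hj i h.1 h.2).2
  obtain ⟨a, ha⟩ := hlo ⟨D - 1, Nat.sub_lt hD one_pos⟩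
  obtain ⟨b, hb⟩ := hhi ⟨D - 1, Nat.sub_lt hD one_pos⟩
  by_cases hc : ∃ i, hi i = c
  · obtain ⟨i₀, rfl⟩ := hc
    obtain ⟨k, hk⟩ := hhi i₀
    have hak : a < k := by
      rw [← hemono.lt_iff_lt, ha, hk]
      exact lt_of_le_of_ne (hloD.trans_le hlc) (hA2 _ _)
    obtain ⟨j, rfl⟩ := Fin.exists_succ_eq.2 ((Fin.zero_le a).trans_lt hak).ne'
    refine ⟨j, ⟨hk ▸ (hemono j.castSucc_lt_succ).le, hk.ge⟩, fun i h₁ h₂ => ⟨?_, hk.trans_le h₂⟩⟩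
    exact lo_le i j (hk ▸ lt_of_le_of_ne h₁ (hA2 _ _))
  · push Not at hc
    obtain ⟨j, hj₁, hj₂⟩ := exists_castSucc_le_lt_succ_s4 (c := c) hemono.monotone
      (ha.trans_le (hloD.trans_le hlc))
      (lt_of_le_of_ne (hcu.trans_eq (hb.trans hhiD).symm) (hb ▸ (hc _).symm))
    exact ⟨j, ⟨hj₁, hj₂.le⟩, fun i h₁ h₂ => ⟨lo_le i j (h₁.trans_lt hj₂),
      le_hi i j (hj₁.trans_lt (lt_of_le_of_ne h₂ (hc i).symm))⟩⟩
end
end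

section
/- Under Assumptions A1 and A2, the infimum inf_{Q ∈ Q̃} ∫ℝ c dQ(c) is finite and equals the optimal value of the linear program: maximize −∑_{i=1}^{D} (q̄_i k_i − q̲_i h_i) over k, h ∈ ℝ^D subject to k_i ≥ 0 and h_i ≥ 0 for all i ∈ {1,…,D} and ∑_{i ∈ D(j)} (k_i − h_i) + L_j ≥ 0 for every j ∈ {1,…,W}; moreover this linear program is feasible and its maximum is attained. -/
open MeasureTheory Set
open scoped Classical

noncomputable section

/-- Feasibility for the dual linear program of the minimization problem: `k, h ≥ 0` and
`∑_{i ∈ D(j)} (k_i − h_i) + L_j ≥ 0` for every elementary subinterval `j`. -/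
def dualFeasMin (D W : ℕ) (lo hi : Fin D → ℝ) (e : Fin (W + 1) → ℝ) (k h : Fin D → ℝ) : Prop :=
  (∀ i, 0 ≤ k i) ∧ (∀ i, 0 ≤ h i) ∧
    ∀ j : Fin W,
      0 ≤ (∑ i ∈ Finset.univ.filter
        (fun i : Fin D => Icc (e j.castSucc) (e j.succ) ⊆ Icc (lo i) (hi i)), (k i - h i))
        + e j.castSucc

/-- The **Farkas lemma** for a family of linear functionals indexed by `Fin m`. -/
theorem exists_nonneg_sum_mul_of_forall_nonneg_fin {V : Type*} [AddCommGroup V] [Module ℝ V] (m : ℕ)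
    (a : Fin m → V →ₗ[ℝ] ℝ) (b : V →ₗ[ℝ] ℝ)
    (hab : ∀ x, (∀ i, 0 ≤ a i x) → 0 ≤ b x) :
    ∃ c : Fin m → ℝ, (∀ i, 0 ≤ c i) ∧ ∀ x, b x = ∑ i, c i * a i x := by
  induction m generalizing b with
  | zero =>
    refine ⟨0, by simp, fun x => ?_⟩
    have h1 := hab x (by simp)
    have h2 := hab (-x) (by simp)
    rw [map_neg] at h2
    simp only [Finset.univ_eq_empty, Finset.sum_empty]
    linarith
  | succ m ih =>
    by_cases hb : ∀ x, (∀ i : Fin m, 0 ≤ a i.castSucc x) → 0 ≤ b x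
    · obtain ⟨c, hc, hbc⟩ := ih (fun i => a i.castSucc) b hb
      refine ⟨Fin.snoc c 0, fun i => ?_, fun x => ?_⟩
      · refine Fin.lastCases ?_ (fun i => ?_) i
        · simp
        · simpa using hc i
      · simp [Fin.sum_univ_castSucc, hbc x]
    · push Not at hb
      obtain ⟨y, hy, hby⟩ := hb
      have hay : a (Fin.last m) y < 0 := by
        by_contra! hcon
        refine absurd (hab y fun i => ?_) (not_le.mpr hby)
        exact Fin.lastCases hcon hy i
      set s := a (Fin.last m) y with hs
      obtain ⟨c, hc, hbc⟩ := ih (fun i => a i.castSucc - (a i.castSucc y / s) • a (Fin.last m))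
        (b - (b y / s) • a (Fin.last m)) (fun x hx => by
          have key : ∀ f : V →ₗ[ℝ] ℝ, f (x - (a (Fin.last m) x / s) • y)
              = (f - (f y / s) • a (Fin.last m)) x := by
            intro f
            simp only [map_sub, map_smul, smul_eq_mul, LinearMap.sub_apply, LinearMap.smul_apply]
            ring
          rw [← key]
          refine hab _ fun i => ?_
          refine Fin.lastCases ?_ (fun i => ?_) i
          · simp only [map_sub, map_smul, smul_eq_mul, ← hs]
            rw [div_mul_cancel₀ _ hay.ne, sub_self]
          · rw [key]
            exact hx i)
      refine ⟨Fin.snoc c (b y / s - ∑ i, c i * (a i.castSucc y / s)), fun i => ?_, fun x => ?_⟩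
      · refine Fin.lastCases ?_ (fun i => ?_) i
        · rw [Fin.snoc_last]
          have h1 : 0 ≤ b y / s := div_nonneg_of_nonpos hby.le hay.le
          have h2 : ∑ i, c i * (a i.castSucc y / s) ≤ 0 := Finset.sum_nonpos fun i _ =>
            mul_nonpos_of_nonneg_of_nonpos (hc i) (div_nonpos_of_nonneg_of_nonpos (hy i) hay.le)
          linarith
        · simpa using hc i
      · have h := hbc x
        simp only [LinearMap.sub_apply, LinearMap.smul_apply, smul_eq_mul, mul_sub,
          Finset.sum_sub_distrib] at h
        rw [Fin.sum_univ_castSucc]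
        simp only [Fin.snoc_castSucc, Fin.snoc_last, sub_mul, Finset.sum_mul]
        simp only [mul_assoc] at h ⊢
        linarith

/-- The **Farkas lemma** for a finite family of linear functionals. -/
theorem exists_nonneg_sum_mul_of_forall_nonneg {V ι : Type*} [AddCommGroup V] [Module ℝ V]
    [Fintype ι] (a : ι → V →ₗ[ℝ] ℝ) (b : V →ₗ[ℝ] ℝ)
    (hab : ∀ x, (∀ i, 0 ≤ a i x) → 0 ≤ b x) :
    ∃ c : ι → ℝ, (∀ i, 0 ≤ c i) ∧ ∀ x, b x = ∑ i, c i * a i x := by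
  let f := Fintype.equivFin ι
  obtain ⟨c, hc, hbc⟩ := exists_nonneg_sum_mul_of_forall_nonneg_fin (Fintype.card ι)
    (fun i => a (f.symm i)) b
    (fun x hx => hab x fun i => by simpa using hx (f i))
  refine ⟨fun i => c (f i), fun i => hc _, fun x => ?_⟩
  rw [hbc x, ← f.sum_comp]
  simp

/-- A point strictly inside an elementary subinterval lies in `[lo i, hi i]` iff the whole
subinterval does. -/
theorem Icc_subset_Icc_iff_mem_of_mem_Ioo {D W : ℕ} {lo hi : Fin D → ℝ} {e : Fin (W + 1) → ℝ}
    (hemono : StrictMono e) (herange : Set.range e = Set.range lo ∪ Set.range hi)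
    {j : Fin W} {x : ℝ} (hx : x ∈ Ioo (e j.castSucc) (e j.succ)) (i : Fin D) :
    Icc (e j.castSucc) (e j.succ) ⊆ Icc (lo i) (hi i) ↔ x ∈ Icc (lo i) (hi i) := by
  refine ⟨fun h => h (Ioo_subset_Icc_self hx), fun h => ?_⟩
  obtain ⟨a, ha⟩ : lo i ∈ range e := herange ▸ Or.inl ⟨i, rfl⟩
  obtain ⟨b, hb⟩ : hi i ∈ range e := herange ▸ Or.inr ⟨i, rfl⟩
  have h1 : a < j.succ := hemono.lt_iff_lt.1 (by linarith [h.1, hx.2])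
  have h2 : j.castSucc < b := hemono.lt_iff_lt.1 (by linarith [h.2, hx.1])
  refine Icc_subset_Icc ?_ ?_
  · rw [← ha]; exact hemono.monotone (Fin.le_castSucc_iff.2 h1)
  · rw [← hb]; exact hemono.monotone (Fin.castSucc_lt_iff_succ_le.1 h2)

/-- Every point of the support belongs to an elementary subinterval that is contained in exactly
those `[lo i, hi i]` which contain the point. -/
theorem exists_elementary_subinterval {D W : ℕ} {lo hi : Fin D → ℝ} {e : Fin (W + 1) → ℝ}
    (hemono : StrictMono e) (herange : Set.range e = Set.range lo ∪ Set.range hi)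
    (hA2 : ∀ i₁ i₂ : Fin D, lo i₁ ≠ hi i₂) (d : Fin D) {x : ℝ} (hx : x ∈ Icc (lo d) (hi d)) :
    ∃ j : Fin W, e j.castSucc ≤ x ∧
      ∀ i, Icc (e j.castSucc) (e j.succ) ⊆ Icc (lo i) (hi i) ↔ x ∈ Icc (lo i) (hi i) := by
  let S : Finset (Fin (W + 1)) :=
    Finset.univ.filter fun a => e a ≤ x ∧ (e a = x → e a ∉ range hi)
  have hmem : ∀ a, a ∈ S ↔ e a ≤ x ∧ (e a = x → e a ∉ range hi) := fun a => by simp [S]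
  obtain ⟨a₀, ha₀⟩ : lo d ∈ range e := herange ▸ Or.inl ⟨d, rfl⟩
  obtain ⟨b₀, hb₀⟩ : hi d ∈ range e := herange ▸ Or.inr ⟨d, rfl⟩
  have hS : S.Nonempty := ⟨a₀, (hmem _).2 ⟨ha₀ ▸ hx.1, fun _ ⟨i, hi'⟩ => hA2 d i (by rw [hi', ha₀])⟩⟩
  obtain ⟨haS, hamax⟩ : S.max' hS ∈ S ∧ ∀ b ∈ S, b ≤ S.max' hS :=
    ⟨S.max'_mem hS, fun b hb => S.le_max' b hb⟩
  generalize S.max' hS = a at haS hamax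
  rw [hmem] at haS
  have hab : a < b₀ := by
    refine hemono.lt_iff_lt.1 (lt_of_le_of_ne (haS.1.trans (hb₀ ▸ hx.2)) fun h => ?_)
    have : e a = x := le_antisymm haS.1 (by rw [h, hb₀]; exact hx.2)
    exact haS.2 this ⟨d, by rw [h, hb₀]⟩
  obtain ⟨j, rfl⟩ := Fin.exists_castSucc_eq.2 (ne_of_lt (hab.trans_le (Fin.le_last b₀)))
  have hnot : j.succ ∉ S := fun h => absurd (hamax _ h) (not_le.2 j.castSucc_lt_succ)
  rw [hmem] at hnot
  have hsucc : x ≤ e j.succ ∧ (e j.succ = x → e j.succ ∈ range hi) := by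
    by_cases h : e j.succ ≤ x
    · have h' : ¬ (e j.succ = x → e j.succ ∉ range hi) := fun h' => hnot ⟨h, h'⟩
      push Not at h'
      exact ⟨h'.1.ge, fun _ => h'.2⟩
    · exact ⟨(not_le.1 h).le, fun h' => absurd h'.le h⟩
  refine ⟨j, haS.1, fun i => ⟨fun h => h ⟨haS.1, hsucc.1⟩, fun h => ?_⟩⟩
  obtain ⟨a, ha⟩ : lo i ∈ range e := herange ▸ Or.inl ⟨i, rfl⟩
  obtain ⟨b, hb⟩ : hi i ∈ range e := herange ▸ Or.inr ⟨i, rfl⟩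
  refine Icc_subset_Icc ?_ ?_
  · rw [← ha]
    refine hemono.monotone (Fin.le_castSucc_iff.2 (not_le.1 fun hle => ?_))
    have h1 : e j.succ ≤ e a := hemono.monotone hle
    have h2 : e j.succ = x := le_antisymm (by linarith [h.1]) hsucc.1
    obtain ⟨i', hi'⟩ := hsucc.2 h2
    exact hA2 i i' (by linarith [h.1])
  · rw [← hb]
    refine hemono.monotone (Fin.castSucc_lt_iff_succ_le.1 (not_le.1 fun hle => ?_))
    have h1 : e b ≤ e j.castSucc := hemono.monotone hle
    have h2 : e j.castSucc = x := le_antisymm haS.1 (by linarith [h.2])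
    exact haS.2 h2 ⟨i, by linarith [h.2]⟩

/-- Weak duality. -/
theorem dual_value_le_integral {D W : ℕ} {lo hi ql qh : Fin D → ℝ} {e : Fin (W + 1) → ℝ}
    (hemono : StrictMono e) (herange : Set.range e = Set.range lo ∪ Set.range hi)
    (hA2 : ∀ i₁ i₂ : Fin D, lo i₁ ≠ hi i₂) (d : Fin D) (hd : ql d = 1)
    {k h : Fin D → ℝ} (hkh : dualFeasMin D W lo hi e k h)
    {Q : Measure ℝ} (hQ : Q ∈ ambSet D lo hi ql qh) :
    -∑ i, (qh i * k i - ql i * h i) ≤ ∫ x, x ∂Q := by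
  obtain ⟨hprob, hQ⟩ := hQ
  have hsupp : ∀ᵐ x ∂Q, x ∈ Icc (lo d) (hi d) := by
    refine (mem_ae_iff_prob_eq_one measurableSet_Icc).2 ?_
    have h1 := (hQ d).1
    refine le_antisymm prob_le_one ?_
    rw [← ENNReal.ofReal_one, ENNReal.ofReal_le_iff_le_toReal (measure_ne_top _ _)]
    linarith
  have hint : Integrable (fun x : ℝ => x) Q :=
    Integrable.of_mem_Icc (lo d) (hi d) aemeasurable_id hsupp
  have hind : ∀ i, Integrable ((Icc (lo i) (hi i)).indicator fun _ => k i - h i) Q :=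
    fun i => (integrable_const _).indicator measurableSet_Icc
  have hle : ∫ x, -∑ i, (Icc (lo i) (hi i)).indicator (fun _ => k i - h i) x ∂Q ≤ ∫ x, x ∂Q := by
    refine integral_mono_ae (integrable_finsetSum _ fun i _ => hind i).neg hint ?_
    filter_upwards [hsupp] with x hx
    obtain ⟨j, hjx, hj⟩ := exists_elementary_subinterval hemono herange hA2 d hx
    have := hkh.2.2 j
    simp only [hj, Finset.sum_filter] at this
    simp only [indicator_apply]
    linarith
  rw [integral_neg, integral_finsetSum _ fun i _ => hind i] at hle
  refine le_trans (neg_le_neg (Finset.sum_le_sum fun i _ => ?_)) hle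
  rw [integral_indicator measurableSet_Icc, setIntegral_const, smul_eq_mul, measureReal_def]
  nlinarith [mul_le_mul_of_nonneg_right (hQ i).2 (hkh.1 i),
    mul_le_mul_of_nonneg_right (hQ i).1 (hkh.2.1 i)]

/-- A finitely supported measure with nonnegative weights `p` satisfying the quantile constraints
belongs to the ambiguity set. -/
theorem sum_smul_dirac_mem_ambSet {D W : ℕ} {lo hi ql qh : Fin D → ℝ} {p x : Fin W → ℝ}
    (hp : ∀ j, 0 ≤ p j) (hp1 : ∑ j, p j = 1)
    (hq : ∀ i, ql i ≤ ∑ j with x j ∈ Icc (lo i) (hi i), p j ∧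
      ∑ j with x j ∈ Icc (lo i) (hi i), p j ≤ qh i) :
    (∑ j, ENNReal.ofReal (p j) • Measure.dirac (x j)) ∈ ambSet D lo hi ql qh := by
  have hval : ∀ s : Set ℝ, MeasurableSet s →
      (∑ j, ENNReal.ofReal (p j) • Measure.dirac (x j)) s
        = ENNReal.ofReal (∑ j with x j ∈ s, p j) := by
    intro s hs
    rw [ENNReal.ofReal_sum_of_nonneg fun j _ => hp j, Finset.sum_filter]
    simp [Measure.finsetSum_apply, hs, indicator_apply]
  refine ⟨⟨?_⟩, fun i => ?_⟩
  · rw [hval _ MeasurableSet.univ]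
    simp [hp1]
  · rw [hval _ measurableSet_Icc, ENNReal.toReal_ofReal (Finset.sum_nonneg fun j _ => hp j)]
    convert hq i

theorem integral_sum_smul_dirac {W : ℕ} {p x : Fin W → ℝ} (hp : ∀ j, 0 ≤ p j) :
    ∫ y, y ∂(∑ j, ENNReal.ofReal (p j) • Measure.dirac (x j)) = ∑ j, p j * x j := by
  rw [integral_finsetSum_measure]
  · simp [integral_smul_measure, hp]
  · intro j _
    exact (integrable_dirac (by simp)).smul_measure ENNReal.ofReal_ne_top

/-- A lower bound on the means over the ambiguity set bounds the discretized primal program. -/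
theorem le_sum_mul_of_forall_le_integral {D W : ℕ} {lo hi ql qh : Fin D → ℝ}
    {e : Fin (W + 1) → ℝ} (hemono : StrictMono e)
    (herange : Set.range e = Set.range lo ∪ Set.range hi) {v : ℝ}
    (hv : ∀ Q ∈ ambSet D lo hi ql qh, v ≤ ∫ x, x ∂Q)
    {p : Fin W → ℝ} (hp : ∀ j, 0 ≤ p j) (hp1 : ∑ j, p j = 1)
    (hq : ∀ i, ql i ≤ ∑ j with Icc (e j.castSucc) (e j.succ) ⊆ Icc (lo i) (hi i), p j ∧
      ∑ j with Icc (e j.castSucc) (e j.succ) ⊆ Icc (lo i) (hi i), p j ≤ qh i) :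
    v ≤ ∑ j, p j * e j.castSucc := by
  set B := ∑ j : Fin W, p j * (e j.succ - e j.castSucc)
  have hbound : ∀ t ∈ Ioo (0 : ℝ) 1, v ≤ (∑ j, p j * e j.castSucc) + t * B := by
    intro t ht
    let x : Fin W → ℝ := fun j => e j.castSucc + t * (e j.succ - e j.castSucc)
    have hx : ∀ j, x j ∈ Ioo (e j.castSucc) (e j.succ) := by
      intro j
      have hj : 0 < e j.succ - e j.castSucc := sub_pos.2 (hemono j.castSucc_lt_succ)
      have h1 := mul_pos ht.1 hj
      have h2 := mul_pos (sub_pos.2 ht.2) hj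
      simp only [x]
      constructor <;> linarith
    refine (hv _ (sum_smul_dirac_mem_ambSet (x := x) hp hp1 fun i => ?_)).trans_eq ?_
    · simpa only [Icc_subset_Icc_iff_mem_of_mem_Ioo hemono herange (hx _) i] using hq i
    · rw [integral_sum_smul_dirac hp, Finset.mul_sum, ← Finset.sum_add_distrib]
      exact Finset.sum_congr rfl fun j _ => by simp only [x]; ring
  have htend : Filter.Tendsto (fun t : ℝ => (∑ j, p j * e j.castSucc) + t * B)
      (nhdsWithin 0 (Ioi 0)) (nhds (∑ j, p j * e j.castSucc)) := by
    have : Continuous fun t : ℝ => (∑ j, p j * e j.castSucc) + t * B := by fun_prop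
    simpa using (this.tendsto 0).mono_left nhdsWithin_le_nhds
  refine ge_of_tendsto htend ?_
  filter_upwards [Ioo_mem_nhdsGT (zero_lt_one (α := ℝ))] with t ht using hbound t ht

/-- Existence of a dual feasible point attaining a lower bound of the means over the ambiguity
set. -/
theorem exists_dualFeasMin_value_eq {D W : ℕ} {lo hi ql qh : Fin D → ℝ}
    {e : Fin (W + 1) → ℝ} (hemono : StrictMono e)
    (herange : Set.range e = Set.range lo ∪ Set.range hi)
    (d : Fin D) (hqld : ql d = 1) (hqhd : qh d = 1)
    (hd : ∀ j : Fin W, Icc (e j.castSucc) (e j.succ) ⊆ Icc (lo d) (hi d)) {v : ℝ}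
    (hv : ∀ Q ∈ ambSet D lo hi ql qh, v ≤ ∫ x, x ∂Q) :
    ∃ k h : Fin D → ℝ, dualFeasMin D W lo hi e k h ∧ -∑ i, (qh i * k i - ql i * h i) = v := by
  let P : Fin D → Fin W → Prop := fun i j => Icc (e j.castSucc) (e j.succ) ⊆ Icc (lo i) (hi i)
  let pj : Fin W → ((Fin W → ℝ) × ℝ) →ₗ[ℝ] ℝ := fun j =>
    (LinearMap.proj j) ∘ₗ LinearMap.fst ℝ (Fin W → ℝ) ℝ
  let tt : ((Fin W → ℝ) × ℝ) →ₗ[ℝ] ℝ := LinearMap.snd ℝ (Fin W → ℝ) ℝ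
  let A : Fin D → ((Fin W → ℝ) × ℝ) →ₗ[ℝ] ℝ := fun i => ∑ j with P i j, pj j
  have hpj : ∀ j z, pj j z = z.1 j := fun _ _ => rfl
  have htt : ∀ z, tt z = z.2 := fun _ => rfl
  have hA : ∀ i z, A i z = ∑ j with P i j, z.1 j := fun i z => by
    simp [A, hpj]
  obtain ⟨c, hc, hbc⟩ := exists_nonneg_sum_mul_of_forall_nonneg
    (ι := Fin W ⊕ Fin D ⊕ Fin D)
    (Sum.elim pj (Sum.elim (fun i => qh i • tt - A i) (fun i => A i - ql i • tt)))
    ((∑ j, e j.castSucc • pj j) - v • tt) (by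
      rintro ⟨p, t⟩ hz
      have hp : ∀ j, 0 ≤ p j := fun j => by simpa [hpj] using hz (Sum.inl j)
      have hu : ∀ i, ∑ j with P i j, p j ≤ qh i * t := fun i => by
        simpa [hA, htt] using hz (Sum.inr (Sum.inl i))
      have hl : ∀ i, ql i * t ≤ ∑ j with P i j, p j := fun i => by
        simpa [hA, htt] using hz (Sum.inr (Sum.inr i))
      have hsum : ∑ j, p j = t := by
        have hfil : (Finset.univ.filter fun j => P d j) = Finset.univ :=
          Finset.filter_true_of_mem fun j _ => hd j
        have h1 := hu d
        have h2 := hl d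
        rw [hfil, hqhd, one_mul] at h1
        rw [hfil, hqld, one_mul] at h2
        exact le_antisymm h1 h2
      suffices v * t ≤ ∑ j, p j * e j.castSucc by
        simpa [hpj, htt, mul_comm] using this
      have ht0 : 0 ≤ t := hsum ▸ Finset.sum_nonneg fun j _ => hp j
      rcases ht0.eq_or_lt with ht | ht
      · have hp0 : ∀ j, p j = 0 := fun j =>
          (Finset.sum_eq_zero_iff_of_nonneg fun j _ => hp j).1 (hsum.trans ht.symm) j
            (Finset.mem_univ j)
        simp [hp0, ← ht]
      · have := le_sum_mul_of_forall_le_integral hemono herange hv (p := fun j => p j / t)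
          (fun j => div_nonneg (hp j) ht.le)
          (by rw [← Finset.sum_div, hsum, div_self ht.ne'])
          (fun i => by
            rw [← Finset.sum_div]
            exact ⟨(le_div_iff₀ ht).2 (hl i), (div_le_iff₀ ht).2 (hu i)⟩)
        simp only [div_mul_eq_mul_div] at this
        rwa [← Finset.sum_div, le_div_iff₀ ht] at this)
  simp only [Fintype.sum_sum_type, Sum.elim_inl, Sum.elim_inr, LinearMap.sub_apply,
    LinearMap.smul_apply, LinearMap.sum_apply, smul_eq_mul, hpj, htt, hA] at hbc
  refine ⟨fun i => c (Sum.inr (Sum.inl i)), fun i => c (Sum.inr (Sum.inr i)),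
    ⟨fun i => hc _, fun i => hc _, fun j => ?_⟩, ?_⟩
  · have h := hbc (Pi.single j 1, 0)
    simp only [P, Pi.single_apply, mul_ite, mul_one, mul_zero, sub_zero,
      zero_sub, mul_neg, Finset.sum_ite_eq', Finset.mem_univ, Finset.mem_filter, true_and, if_true,
      Finset.sum_neg_distrib] at h
    have h' := hc (Sum.inl j)
    rw [← Finset.sum_filter, ← Finset.sum_filter] at h
    rw [Finset.sum_sub_distrib]
    linarith
  · have h := hbc (0, 1)
    simp only [Pi.zero_apply, mul_zero, Finset.sum_const_zero, mul_one, zero_sub, sub_zero,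
      zero_add, mul_neg, Finset.sum_neg_distrib] at h
    simp only [Finset.sum_sub_distrib, mul_comm (qh _), mul_comm (ql _)]
    linarith

/-- Under Assumptions A1 and A2, `inf_{Q ∈ Q̃} ∫ c dQ` is finite and equals the optimal value of
the linear program maximizing `−∑_i (q̄_i k_i − q̲_i h_i)`; moreover the LP is feasible and its
maximum is attained. -/
theorem stmt_5 (D W : ℕ) (hD : 0 < D)
    (l u : ℝ) (hl0 : 0 ≤ l) (hlu : l ≤ u)
    (lo hi ql qh : Fin D → ℝ)
    (hllo : ∀ i, l ≤ lo i) (hlohi : ∀ i, lo i ≤ hi i) (hhiu : ∀ i, hi i ≤ u)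
    (hql0 : ∀ i, 0 ≤ ql i) (hqlqh : ∀ i, ql i ≤ qh i) (hqh1 : ∀ i, qh i ≤ 1)
    (hloD : lo ⟨D - 1, Nat.sub_lt hD one_pos⟩ = l)
    (hhiD : hi ⟨D - 1, Nat.sub_lt hD one_pos⟩ = u)
    (hqlD : ql ⟨D - 1, Nat.sub_lt hD one_pos⟩ = 1)
    (hqhD : qh ⟨D - 1, Nat.sub_lt hD one_pos⟩ = 1)
    (e : Fin (W + 1) → ℝ) (hemono : StrictMono e)
    (herange : Set.range e = Set.range lo ∪ Set.range hi)
    (hA1 : ∃ Q ∈ ambSet D lo hi ql qh, ∀ i : Fin D, ql i < qh i →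
      ql i < (Q (Icc (lo i) (hi i))).toReal ∧ (Q (Icc (lo i) (hi i))).toReal < qh i)
    (hA2 : ∀ i₁ i₂ : Fin D, lo i₁ ≠ hi i₂) :
    ((fun Q : Measure ℝ => ∫ x, x ∂Q) '' ambSet D lo hi ql qh).Nonempty ∧
    BddBelow ((fun Q : Measure ℝ => ∫ x, x ∂Q) '' ambSet D lo hi ql qh) ∧
    ∃ k h : Fin D → ℝ, dualFeasMin D W lo hi e k h ∧
      (∀ k' h' : Fin D → ℝ, dualFeasMin D W lo hi e k' h' →
        (-∑ i, (qh i * k' i - ql i * h' i)) ≤ -∑ i, (qh i * k i - ql i * h i)) ∧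
      sInf ((fun Q : Measure ℝ => ∫ x, x ∂Q) '' ambSet D lo hi ql qh) =
        -∑ i, (qh i * k i - ql i * h i) := by
  have hmem : ∀ x ∈ range e, l ≤ x ∧ x ≤ u := by
    rw [herange]
    rintro x (⟨i, rfl⟩ | ⟨i, rfl⟩)
    · exact ⟨hllo i, (hlohi i).trans (hhiu i)⟩
    · exact ⟨(hllo i).trans (hlohi i), hhiu i⟩
  set d : Fin D := ⟨D - 1, Nat.sub_lt hD one_pos⟩
  have hd : ∀ j : Fin W, Icc (e j.castSucc) (e j.succ) ⊆ Icc (lo d) (hi d) := fun j => by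
    rw [hloD, hhiD]
    exact Icc_subset_Icc (hmem _ ⟨_, rfl⟩).1 (hmem _ ⟨_, rfl⟩).2
  obtain ⟨Q₀, hQ₀, -⟩ := hA1
  have hne : ((fun Q : Measure ℝ => ∫ x, x ∂Q) '' ambSet D lo hi ql qh).Nonempty :=
    ⟨_, Q₀, hQ₀, rfl⟩
  have hweak : ∀ k h : Fin D → ℝ, dualFeasMin D W lo hi e k h →
      -∑ i, (qh i * k i - ql i * h i) ∈
        lowerBounds ((fun Q : Measure ℝ => ∫ x, x ∂Q) '' ambSet D lo hi ql qh) := by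
    rintro k h hkh _ ⟨Q, hQ, rfl⟩
    exact dual_value_le_integral hemono herange hA2 d hqlD hkh hQ
  have hfeas : dualFeasMin D W lo hi e 0 0 :=
    ⟨fun _ => le_rfl, fun _ => le_rfl, fun j => by
      simpa using hl0.trans (hmem _ ⟨j.castSucc, rfl⟩).1⟩
  have hbdd : BddBelow ((fun Q : Measure ℝ => ∫ x, x ∂Q) '' ambSet D lo hi ql qh) :=
    ⟨_, hweak 0 0 hfeas⟩
  obtain ⟨k, h, hkh, hval⟩ := exists_dualFeasMin_value_eq hemono herange d hqlD hqhD hd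
    (fun Q hQ => csInf_le hbdd ⟨Q, hQ, rfl⟩)
  refine ⟨hne, hbdd, k, h, hkh, fun k' h' hkh' => ?_, hval.symm⟩
  rw [hval]
  exact le_csInf hne (hweak k' h' hkh')
end
end

section
/- Assume that for every a ∈ A the set Q̃_a is nonempty and both c^min_a := inf_{Q_a ∈ Q̃_a} E_{Q_a}[c_a] and c^max_a := sup_{Q_a ∈ Q̃_a} E_{Q_a}[c_a] are attained by some measures in Q̃_a, and assume S ≠ ∅. Then for every y ∈ Y one has sup_{Q ∈ Q} E_Q[∑_{a∈A} c_a y_a] = max_{c̄ ∈ S} ∑_{a∈A} c̄_a y_a, and consequently the distributionally robust shortest path problem equals a robust shortest path problem with polyhedral uncertainty: min_{y ∈ Y} sup_{Q ∈ Q} E_Q[∑_{a∈A} c_a y_a] = min_{y ∈ Y} max_{c̄ ∈ S} ∑_{a∈A} c̄_a y_a. -/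
open MeasureTheory Set

noncomputable section

/-- The best-case expected arc cost `c^min_a`. -/
def cmin (D : ℕ) (lo hi ql qh : Fin D → ℝ) : ℝ :=
  sInf ((fun Q : Measure ℝ => ∫ x, x ∂Q) '' ambSet D lo hi ql qh)

/-- The worst-case expected arc cost `c^max_a`. -/
def cmax (D : ℕ) (lo hi ql qh : Fin D → ℝ) : ℝ :=
  sSup ((fun Q : Measure ℝ => ∫ x, x ∂Q) '' ambSet D lo hi ql qh)

/-- The mean of the marginal of `Q` at coordinate `a`. -/
def margMean {A : Type*} [Fintype A] (Q : Measure (A → ℝ)) (a : A) : ℝ :=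
  ∫ x, x ∂(Q.map (fun c => c a))

/-- The full ambiguity set `Q`: joint distributions whose marginals lie in the `Q̃_a` and whose
mean vector `m(Q)` satisfies the linear expectation constraints `B m(Q) ≤ b`. -/
def ambJoint {A : Type*} [Fintype A] (D : A → ℕ) (lo hi ql qh : (a : A) → Fin (D a) → ℝ)
    (D0 : ℕ) (B : Fin D0 → A → ℝ) (b : Fin D0 → ℝ) : Set (Measure (A → ℝ)) :=
  {Q | IsProbabilityMeasure Q ∧
    (∀ a : A, Q.map (fun c => c a) ∈ ambSet (D a) (lo a) (hi a) (ql a) (qh a)) ∧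
    ∀ d : Fin D0, (∑ a, B d a * margMean Q a) ≤ b d}

/-- The polyhedral uncertainty set `S`. -/
def polyS {A : Type*} [Fintype A] (D : A → ℕ) (lo hi ql qh : (a : A) → Fin (D a) → ℝ)
    (D0 : ℕ) (B : Fin D0 → A → ℝ) (b : Fin D0 → ℝ) : Set (A → ℝ) :=
  {cbar | (∀ a : A, cmin (D a) (lo a) (hi a) (ql a) (qh a) ≤ cbar a ∧
      cbar a ≤ cmax (D a) (lo a) (hi a) (ql a) (qh a)) ∧
    ∀ d : Fin D0, (∑ a, B d a * cbar a) ≤ b d}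

section ArcMarginals

variable {D : ℕ} {lo hi ql qh : Fin D → ℝ} {Q : Measure ℝ}

lemma ae_mem_Icc_of_mem_ambSet {j : Fin D} (hj : ql j = 1) (hQ : Q ∈ ambSet D lo hi ql qh) :
    ∀ᵐ x ∂Q, x ∈ Icc (lo j) (hi j) := by
  obtain ⟨hP, hQ⟩ := hQ
  have h : Q.real (Icc (lo j) (hi j)) = 1 :=
    le_antisymm measureReal_le_one (hj ▸ (hQ j).1)
  have h0 : Q.real (Icc (lo j) (hi j))ᶜ = 0 := by
    rw [probReal_compl_eq_one_sub measurableSet_Icc, h, sub_self]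
  exact (measureReal_eq_zero_iff).1 h0

lemma integrable_of_mem_ambSet {j : Fin D} (hj : ql j = 1) (hQ : Q ∈ ambSet D lo hi ql qh) :
    Integrable (fun x : ℝ => x) Q := by
  have hP := hQ.1
  exact Integrable.of_mem_Icc _ _ measurable_id.aemeasurable (ae_mem_Icc_of_mem_ambSet hj hQ)

lemma integral_mem_Icc_of_mem_ambSet {j : Fin D} (hj : ql j = 1)
    (hQ : Q ∈ ambSet D lo hi ql qh) : ∫ x, x ∂Q ∈ Icc (lo j) (hi j) := by
  have hP := hQ.1
  exact (convex_Icc _ _).integral_mem isClosed_Icc (ae_mem_Icc_of_mem_ambSet hj hQ)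
    (integrable_of_mem_ambSet hj hQ)

lemma integral_mem_Icc_cmin_cmax {j : Fin D} (hj : ql j = 1) (hQ : Q ∈ ambSet D lo hi ql qh) :
    ∫ x, x ∂Q ∈ Icc (cmin D lo hi ql qh) (cmax D lo hi ql qh) := by
  refine ⟨csInf_le ⟨lo j, ?_⟩ ⟨Q, hQ, rfl⟩, le_csSup ⟨hi j, ?_⟩ ⟨Q, hQ, rfl⟩⟩
  · rintro _ ⟨R, hR, rfl⟩
    exact (integral_mem_Icc_of_mem_ambSet hj hR).1
  · rintro _ ⟨R, hR, rfl⟩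
    exact (integral_mem_Icc_of_mem_ambSet hj hR).2

lemma smul_add_smul_mem_ambSet {Q₁ Q₂ : Measure ℝ} (h₁ : Q₁ ∈ ambSet D lo hi ql qh)
    (h₂ : Q₂ ∈ ambSet D lo hi ql qh) {s t : ℝ} (hs : 0 ≤ s) (ht : 0 ≤ t) (hst : s + t = 1) :
    ENNReal.ofReal s • Q₁ + ENNReal.ofReal t • Q₂ ∈ ambSet D lo hi ql qh := by
  have hP₁ := h₁.1
  have hP₂ := h₂.1
  refine ⟨⟨?_⟩, fun i => ?_⟩
  · simp [← ENNReal.ofReal_add hs ht, hst]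
  · have hval : ((ENNReal.ofReal s • Q₁ + ENNReal.ofReal t • Q₂) (Icc (lo i) (hi i))).toReal
        = s * (Q₁ (Icc (lo i) (hi i))).toReal + t * (Q₂ (Icc (lo i) (hi i))).toReal := by
      simp only [Measure.add_apply, Measure.smul_apply, smul_eq_mul]
      rw [ENNReal.toReal_add (by finiteness) (by finiteness), ENNReal.toReal_mul,
        ENNReal.toReal_mul, ENNReal.toReal_ofReal hs, ENNReal.toReal_ofReal ht]
    rw [hval]
    exact (convex_Icc (ql i) (qh i)) (h₁.2 i) (h₂.2 i) hs ht hst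

lemma exists_mem_ambSet_integral_eq {j : Fin D} (hj : ql j = 1)
    (hmin : ∃ Q ∈ ambSet D lo hi ql qh, ∫ x, x ∂Q = cmin D lo hi ql qh)
    (hmax : ∃ Q ∈ ambSet D lo hi ql qh, ∫ x, x ∂Q = cmax D lo hi ql qh)
    {v : ℝ} (hv : v ∈ Icc (cmin D lo hi ql qh) (cmax D lo hi ql qh)) :
    ∃ Q ∈ ambSet D lo hi ql qh, ∫ x, x ∂Q = v := by
  obtain ⟨Q₁, h₁, e₁⟩ := hmin
  obtain ⟨Q₂, h₂, e₂⟩ := hmax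
  rw [← segment_eq_Icc (hv.1.trans hv.2)] at hv
  obtain ⟨s, t, hs, ht, hst, rfl⟩ := hv
  refine ⟨_, smul_add_smul_mem_ambSet h₁ h₂ hs ht hst, ?_⟩
  rw [integral_add_measure ((integrable_of_mem_ambSet hj h₁).smul_measure (by finiteness))
    ((integrable_of_mem_ambSet hj h₂).smul_measure (by finiteness)), integral_smul_measure,
    integral_smul_measure, ENNReal.toReal_ofReal hs, ENNReal.toReal_ofReal ht, e₁, e₂]

end ArcMarginals

section JointDistributions

variable {A : Type*} [Fintype A] {D : A → ℕ} {lo hi ql qh : (a : A) → Fin (D a) → ℝ}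
  {D0 : ℕ} {B : Fin D0 → A → ℝ} {b : Fin D0 → ℝ}

lemma integral_sum_mul_eq_sum_margMean {j : (a : A) → Fin (D a)} (hj : ∀ a, ql a (j a) = 1)
    {Q : Measure (A → ℝ)} (hQ : Q ∈ ambJoint D lo hi ql qh D0 B b) (y : A → ℝ) :
    ∫ c, ∑ a, c a * y a ∂Q = ∑ a, margMean Q a * y a := by
  have hint : ∀ a, Integrable (fun c : A → ℝ => c a) Q := fun a =>
    (integrable_of_mem_ambSet (hj a) (hQ.2.1 a)).comp_measurable (measurable_pi_apply a)
  rw [integral_finsetSum _ fun a _ => (hint a).mul_const (y a)]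
  refine Finset.sum_congr rfl fun a _ => ?_
  rw [integral_mul_const, margMean,
    integral_map (measurable_pi_apply a).aemeasurable (by fun_prop)]

lemma margMean_image_ambJoint {j : (a : A) → Fin (D a)} (hj : ∀ a, ql a (j a) = 1)
    (hmin : ∀ a, ∃ Q ∈ ambSet (D a) (lo a) (hi a) (ql a) (qh a),
      ∫ x, x ∂Q = cmin (D a) (lo a) (hi a) (ql a) (qh a))
    (hmax : ∀ a, ∃ Q ∈ ambSet (D a) (lo a) (hi a) (ql a) (qh a),
      ∫ x, x ∂Q = cmax (D a) (lo a) (hi a) (ql a) (qh a)) :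
    margMean '' ambJoint D lo hi ql qh D0 B b = polyS D lo hi ql qh D0 B b := by
  ext v
  constructor
  · rintro ⟨Q, hQ, rfl⟩
    exact ⟨fun a => integral_mem_Icc_cmin_cmax (hj a) (hQ.2.1 a), hQ.2.2⟩
  · intro hv
    choose Q hQ hQv using fun a =>
      exists_mem_ambSet_integral_eq (hj a) (hmin a) (hmax a) (hv.1 a)
    have hP : ∀ a, IsProbabilityMeasure (Q a) := fun a => (hQ a).1
    have hmap : ∀ a, (Measure.pi Q).map (fun c => c a) = Q a := fun a =>
      (measurePreserving_eval Q a).map_eq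
    have hmean : margMean (Measure.pi Q) = v := by
      funext a
      rw [margMean, hmap, hQv]
    refine ⟨Measure.pi Q, ⟨inferInstance, fun a => (hmap a).symm ▸ hQ a, ?_⟩, hmean⟩
    rw [hmean]
    exact hv.2

lemma integral_image_ambJoint {j : (a : A) → Fin (D a)} (hj : ∀ a, ql a (j a) = 1)
    (hmin : ∀ a, ∃ Q ∈ ambSet (D a) (lo a) (hi a) (ql a) (qh a),
      ∫ x, x ∂Q = cmin (D a) (lo a) (hi a) (ql a) (qh a))
    (hmax : ∀ a, ∃ Q ∈ ambSet (D a) (lo a) (hi a) (ql a) (qh a),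
      ∫ x, x ∂Q = cmax (D a) (lo a) (hi a) (ql a) (qh a)) (y : A → ℝ) :
    (fun Q : Measure (A → ℝ) => ∫ c, ∑ a, c a * y a ∂Q) '' ambJoint D lo hi ql qh D0 B b =
      (fun cbar : A → ℝ => ∑ a, cbar a * y a) '' polyS D lo hi ql qh D0 B b := by
  rw [← margMean_image_ambJoint hj hmin hmax, image_image]
  exact image_congr fun Q hQ => integral_sum_mul_eq_sum_margMean hj hQ y

lemma isCompact_polyS : IsCompact (polyS D lo hi ql qh D0 B b) := by
  have hbox : IsCompact (Icc (fun a => cmin (D a) (lo a) (hi a) (ql a) (qh a))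
      (fun a => cmax (D a) (lo a) (hi a) (ql a) (qh a))) := isCompact_Icc
  have hclosed : IsClosed {v : A → ℝ | ∀ d, ∑ a, B d a * v a ≤ b d} := by
    simp only [ofPred_forall]
    exact isClosed_iInter fun d => isClosed_le (by fun_prop) continuous_const
  convert hbox.inter_right hclosed using 1
  ext v
  simp [polyS, Pi.le_def, forall_and]

end JointDistributions

/-- If every `Q̃_a` is nonempty with attained extremal means and `S ≠ ∅`, then for every `y ∈ Y`
the worst-case expectation over `Q` equals `max_{c̄ ∈ S} ∑_a c̄_a y_a`, and the distributionally
robust shortest path problem equals the robust shortest path problem over `S`. -/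
theorem stmt_7 {A : Type*} [Fintype A] [Nonempty A]
    (D : A → ℕ) (hD : ∀ a, 0 < D a)
    (l u : A → ℝ) (hl0 : ∀ a, 0 ≤ l a) (hlu : ∀ a, l a ≤ u a)
    (lo hi ql qh : (a : A) → Fin (D a) → ℝ)
    (hllo : ∀ a i, l a ≤ lo a i) (hlohi : ∀ a i, lo a i ≤ hi a i) (hhiu : ∀ a i, hi a i ≤ u a)
    (hql0 : ∀ a i, 0 ≤ ql a i) (hqlqh : ∀ a i, ql a i ≤ qh a i) (hqh1 : ∀ a i, qh a i ≤ 1)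
    (hloD : ∀ a, lo a ⟨D a - 1, Nat.sub_lt (hD a) one_pos⟩ = l a)
    (hhiD : ∀ a, hi a ⟨D a - 1, Nat.sub_lt (hD a) one_pos⟩ = u a)
    (hqlD : ∀ a, ql a ⟨D a - 1, Nat.sub_lt (hD a) one_pos⟩ = 1)
    (hqhD : ∀ a, qh a ⟨D a - 1, Nat.sub_lt (hD a) one_pos⟩ = 1)
    (hne : ∀ a, (ambSet (D a) (lo a) (hi a) (ql a) (qh a)).Nonempty)
    (hminAtt : ∀ a, ∃ Q ∈ ambSet (D a) (lo a) (hi a) (ql a) (qh a),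
      (∫ x, x ∂Q) = cmin (D a) (lo a) (hi a) (ql a) (qh a))
    (hmaxAtt : ∀ a, ∃ Q ∈ ambSet (D a) (lo a) (hi a) (ql a) (qh a),
      (∫ x, x ∂Q) = cmax (D a) (lo a) (hi a) (ql a) (qh a))
    (D0 : ℕ) (B : Fin D0 → A → ℝ) (b : Fin D0 → ℝ)
    (hS : (polyS D lo hi ql qh D0 B b).Nonempty)
    (Y : Finset (A → ℝ)) (hY : Y.Nonempty)
    (hY01 : ∀ y ∈ Y, ∀ a, y a = 0 ∨ y a = 1) :
    (∀ y ∈ Y, ∃ cbar ∈ polyS D lo hi ql qh D0 B b,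
      (∀ cbar' ∈ polyS D lo hi ql qh D0 B b, (∑ a, cbar' a * y a) ≤ ∑ a, cbar a * y a) ∧
      sSup ((fun Q : Measure (A → ℝ) => ∫ c, ∑ a, c a * y a ∂Q) ''
          ambJoint D lo hi ql qh D0 B b) = ∑ a, cbar a * y a) ∧
    sInf ((fun y : A → ℝ =>
        sSup ((fun Q : Measure (A → ℝ) => ∫ c, ∑ a, c a * y a ∂Q) ''
          ambJoint D lo hi ql qh D0 B b)) '' (Y : Set (A → ℝ))) =
      sInf ((fun y : A → ℝ =>
        sSup ((fun cbar : A → ℝ => ∑ a, cbar a * y a) '' polyS D lo hi ql qh D0 B b)) ''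
          (Y : Set (A → ℝ))) := by
  have hset := integral_image_ambJoint (B := B) (b := b) hqlD hminAtt hmaxAtt
  refine ⟨fun y _ => ?_, by simp only [hset]⟩
  obtain ⟨cbar, hcbar, hmax⟩ :=
    isCompact_polyS.exists_isMaxOn hS (f := fun v : A → ℝ => ∑ a, v a * y a) (by fun_prop)
  refine ⟨cbar, hcbar, fun v hv => hmax hv, ?_⟩
  rw [hset y]
  refine IsGreatest.csSup_eq ⟨⟨cbar, hcbar, rfl⟩, ?_⟩
  rintro _ ⟨v, hv, rfl⟩
  exact hmax hv
end
end

section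
/- Let 0 ≤ l ≤ u < ∞ and μ̂, σ̂ ≥ 0 satisfy l ≤ min{μ̂, σ̂} ≤ u. Define Q₂ := {Q Borel probability measure on ℝ : Q([l, u]) = 1, E_Q[c] ≤ μ̂, and E_Q[c²] ≤ σ̂²}. Then sup_{Q ∈ Q₂} E_Q[c] = min{μ̂, σ̂}, and this supremum is attained by the Dirac measure concentrated at the point min{μ̂, σ̂}. -/
open MeasureTheory Set

noncomputable section

/-- The marginal moment ambiguity set `Q₂`: Borel probability measures supported in `[l, u]`
with mean at most `μ̂` and second moment at most `σ̂²`. -/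
def momSet (l u muHat sigHat : ℝ) : Set (Measure ℝ) :=
  {Q | IsProbabilityMeasure Q ∧ Q (Icc l u) = 1 ∧
    (∫ x, x ∂Q) ≤ muHat ∧ (∫ x, x ^ 2 ∂Q) ≤ sigHat ^ 2}

/-- The mean of a probability measure concentrated on a bounded interval is at most any `s ≥ 0`
whose square bounds the second moment. -/
theorem integral_id_le_of_integral_sq_le {Q : Measure ℝ} [IsProbabilityMeasure Q] {l u s : ℝ}
    (hQ : Q (Icc l u) = 1) (hs : 0 ≤ s) (h : ∫ x, x ^ 2 ∂Q ≤ s ^ 2) : ∫ x, x ∂Q ≤ s := by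
  have hae : ∀ᵐ x ∂Q, x ∈ Icc l u := by
    rw [← mem_ae_iff_prob_eq_one measurableSet_Icc] at hQ
    exact hQ
  have hL : MemLp (id : ℝ → ℝ) 2 Q :=
    memLp_of_bounded hae aestronglyMeasurable_id 2
  have hv := ProbabilityTheory.variance_nonneg (id : ℝ → ℝ) Q
  rw [ProbabilityTheory.variance_eq_sub hL] at hv
  simp only [Pi.pow_apply, id_eq] at hv
  exact le_of_abs_le (abs_le_of_sq_le_sq (by linarith) hs)

/-- For `0 ≤ l ≤ u`, `μ̂, σ̂ ≥ 0` with `l ≤ min{μ̂, σ̂} ≤ u`, the worst-case mean over `Q₂`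
equals `min{μ̂, σ̂}` and is attained by the Dirac measure at `min{μ̂, σ̂}`. -/
theorem stmt_10 (l u muHat sigHat : ℝ)
    (hl0 : 0 ≤ l) (hlu : l ≤ u)
    (hmu : 0 ≤ muHat) (hsig : 0 ≤ sigHat)
    (hlmin : l ≤ min muHat sigHat) (hminu : min muHat sigHat ≤ u) :
    sSup ((fun Q : Measure ℝ => ∫ x, x ∂Q) '' momSet l u muHat sigHat) = min muHat sigHat ∧
    (Measure.dirac (min muHat sigHat) ∈ momSet l u muHat sigHat) ∧
    (∫ x, x ∂(Measure.dirac (min muHat sigHat) : Measure ℝ)) = min muHat sigHat := by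
  have hdirac : Measure.dirac (min muHat sigHat) ∈ momSet l u muHat sigHat := by
    refine ⟨inferInstance, ?_, ?_, ?_⟩
    · simp [Measure.dirac_apply' _ measurableSet_Icc, hlmin, hminu]
    · rw [integral_dirac]
      exact min_le_left _ _
    · rw [integral_dirac]
      exact pow_le_pow_left₀ (le_min hmu hsig) (min_le_right _ _) 2
  refine ⟨IsGreatest.csSup_eq ⟨⟨_, hdirac, integral_dirac _ _⟩, ?_⟩, hdirac, integral_dirac _ _⟩
  rintro _ ⟨Q, ⟨hprob, hQ, hmean, hsq⟩, rfl⟩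
  exact le_min hmean (integral_id_le_of_integral_sq_le hQ hsig hsq)
end
end

section
/- Let Q̃₀ := {Q Borel probability measure on ℝ : Q([0, 100]) = 1, Q([0, 50]) = 1/2, and Q([50, 100]) = 1/2}. Then Q̃₀ is nonempty, sup_{Q ∈ Q̃₀} ∫ c dQ(c) = 75, and no measure Q ∈ Q̃₀ attains this supremum (illustrating that the maximum in the moment problem may fail to exist when Assumption A2 is violated). -/
open MeasureTheory Set

noncomputable section

/-- The ambiguity set of Example 1: Borel probability measures on `ℝ` supported in `[0, 100]`
that assign probability `1/2` to each of the overlapping subintervals `[0, 50]` and `[50, 100]`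
(Assumption A2 fails at the shared endpoint `50`). -/
def exSet : Set (Measure ℝ) :=
  {Q | IsProbabilityMeasure Q ∧ Q (Icc (0 : ℝ) 100) = 1 ∧
    (Q (Icc (0 : ℝ) 50)).toReal = 1 / 2 ∧ (Q (Icc (50 : ℝ) 100)).toReal = 1 / 2}

/-- The equal mixture of the point masses at `t` and at `100`. -/
def halfDirac (t : ℝ) : Measure ℝ :=
  (2⁻¹ : ENNReal) • Measure.dirac t + (2⁻¹ : ENNReal) • Measure.dirac 100

lemma halfDirac_mem {t : ℝ} (h0 : 0 ≤ t) (h1 : t < 50) : halfDirac t ∈ exSet := by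
  have h2 : t ≤ 100 := by linarith
  refine ⟨⟨?_⟩, ?_, ?_, ?_⟩
  · simp [halfDirac, ENNReal.inv_two_add_inv_two]
  · simp [halfDirac, h0, h2, ENNReal.inv_two_add_inv_two]
  · have : ¬ (100 : ℝ) ≤ 50 := by norm_num
    simp [halfDirac, h0, h1.le, this]
  · have : (50 : ℝ) ≤ 100 := by norm_num
    simp [halfDirac, h1, this]

lemma integral_halfDirac (t : ℝ) : ∫ x, x ∂(halfDirac t) = (t + 100) / 2 := by
  have hi (a : ℝ) : Integrable (fun x : ℝ => x) ((2⁻¹ : ENNReal) • Measure.dirac a) :=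
    (integrable_dirac (by simp)).smul_measure (by simp)
  rw [halfDirac, integral_add_measure (hi t) (hi 100), integral_smul_measure,
    integral_smul_measure, integral_dirac, integral_dirac]
  simp
  ring

lemma measure_singleton_of_mem_exSet {Q : Measure ℝ} (hQ : Q ∈ exSet) : Q {50} = 0 := by
  obtain ⟨hp, h, h1, h2⟩ := hQ
  have hu : Icc (0 : ℝ) 50 ∪ Icc 50 100 = Icc 0 100 :=
    Icc_union_Icc_eq_Icc (by norm_num) (by norm_num)
  have hi : Icc (0 : ℝ) 50 ∩ Icc 50 100 = {50} :=
    Icc_inter_Icc_eq_singleton (by norm_num) (by norm_num)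
  have key := measureReal_union_add_inter (μ := Q) (s := Icc (0 : ℝ) 50)
    (t := Icc (50 : ℝ) 100) measurableSet_Icc
  rw [hu, hi] at key
  simp only [measureReal_def, h, h1, h2] at key
  have : (Q {50}).toReal = 0 := by norm_num at key; exact key
  exact (ENNReal.toReal_eq_zero_iff _).1 this |>.resolve_right (measure_ne_top _ _)

lemma integral_lt_of_mem_exSet {Q : Measure ℝ} (hQ : Q ∈ exSet) : ∫ x, x ∂Q < 75 := by
  have h50 := measure_singleton_of_mem_exSet hQ
  obtain ⟨hp, h, h1, h2⟩ := hQ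
  have hs : ∀ᵐ x ∂Q, x ∈ Icc (0 : ℝ) 100 :=
    (mem_ae_iff_prob_eq_one measurableSet_Icc).2 h
  set g : ℝ → ℝ := fun x => 100 - (Icc (0 : ℝ) 50).indicator (fun _ => (50 : ℝ)) x with hg
  have hind : Integrable ((Icc (0 : ℝ) 50).indicator (fun _ => (50 : ℝ))) Q :=
    (integrable_const _).indicator measurableSet_Icc
  have hgi : Integrable g Q := (integrable_const _).sub hind
  have hxi : Integrable (fun x : ℝ => x) Q := by
    refine Integrable.of_bound measurable_id.aestronglyMeasurable 100 ?_
    filter_upwards [hs] with x hx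
    rw [Real.norm_eq_abs, abs_of_nonneg hx.1]
    exact hx.2
  have hle : (fun x : ℝ => x) ≤ᵐ[Q] g := by
    filter_upwards [hs] with x hx
    by_cases hx' : x ∈ Icc (0 : ℝ) 50
    · simp only [hg, indicator_of_mem hx']
      linarith [hx'.2]
    · simp only [hg, indicator_of_notMem hx']
      linarith [hx.2]
  have hgint : ∫ x, g x ∂Q = 75 := by
    rw [integral_sub (integrable_const _) hind, integral_indicator_const _ measurableSet_Icc,
      measureReal_def, h1]
    norm_num
  rw [← hgint]
  refine lt_of_le_of_ne (integral_mono_ae hxi hgi hle) fun heq => ?_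
  have hae := (integral_eq_iff_of_ae_le hxi hgi hle).1 heq
  have hne : ∀ᵐ x ∂Q, x ≠ 50 := by
    rw [ae_iff]
    simpa using h50
  have hnot : ∀ᵐ x ∂Q, x ∉ Icc (0 : ℝ) 50 := by
    filter_upwards [hae, hne] with x hx hx50 hmem
    simp only [hg, indicator_of_mem hmem] at hx
    exact hx50 (by linarith)
  have hzero : Q (Icc (0 : ℝ) 50) = 0 := measure_eq_zero_iff_ae_notMem.2 hnot
  rw [hzero] at h1
  norm_num at h1

/-- The set is nonempty, the supremum of the means over it equals `75`, and no measure in the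
set attains this supremum: the maximum in the moment problem may fail to exist when
Assumption A2 is violated. -/
theorem stmt_11 :
    exSet.Nonempty ∧
    sSup ((fun Q : Measure ℝ => ∫ x, x ∂Q) '' exSet) = 75 ∧
    ∀ Q ∈ exSet, (∫ x, x ∂Q) ≠ 75 := by
  have hne : exSet.Nonempty := ⟨halfDirac 0, halfDirac_mem le_rfl (by norm_num)⟩
  refine ⟨hne, csSup_eq_of_forall_le_of_forall_lt_exists_gt (hne.image _) ?_ ?_,
    fun Q hQ => (integral_lt_of_mem_exSet hQ).ne⟩
  · rintro _ ⟨Q, hQ, rfl⟩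
    exact (integral_lt_of_mem_exSet hQ).le
  · intro w hw
    obtain ⟨t, ht, ht'⟩ := exists_between (max_lt (by norm_num : (0 : ℝ) < 50)
      (by linarith : 2 * w - 100 < 50))
    refine ⟨_, ⟨halfDirac t, halfDirac_mem ((le_max_left _ _).trans ht.le) ht', rfl⟩, ?_⟩
    simp only [integral_halfDirac]
    linarith [(le_max_right _ _).trans_lt ht]
end
end

section
/- Assume Assumptions A1 and A2, set c^min := inf_{Q ∈ Q̃} ∫ c dQ and c^max := sup_{Q ∈ Q̃} ∫ c dQ, and fix c̄ ∈ [c^min, c^max]. Then every dual feasible solution has nonnegative objective value: for all k, h ∈ ℝ^D with k ≥ 0 and h ≥ 0 and every γ ∈ ℝ such that ∑_{i ∈ D(j)} (k_i − h_i) + min{γ L_j, γ U_j} ≥ 0 for every j ∈ {1,…,W}, one has ∑_{i=1}^{D} (q̄_i k_i − q̲_i h_i) + c̄ γ ≥ 0. -/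
open MeasureTheory Set
open scoped Classical

noncomputable section

/-- The set of achievable means `{∫ c dQ : Q ∈ Q̃}`. -/
def meanSet (D : ℕ) (lo hi ql qh : Fin D → ℝ) : Set ℝ :=
  (fun Q : Measure ℝ => ∫ x, x ∂Q) '' ambSet D lo hi ql qh

/-- If no left endpoint is a right endpoint, every point of the support lies in an elementary
subinterval that is contained in exactly those intervals that contain the point. -/
lemma exists_elementary_interval {ι : Type*} {W : ℕ} {lo hi : ι → ℝ} {e : Fin (W + 1) → ℝ}
    (hemono : StrictMono e) (herange : Set.range e = Set.range lo ∪ Set.range hi)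
    (hne : ∀ i₁ i₂, lo i₁ ≠ hi i₂) (i₀ : ι) {x : ℝ} (hx : x ∈ Icc (lo i₀) (hi i₀)) :
    ∃ j : Fin W, x ∈ Icc (e j.castSucc) (e j.succ) ∧
      ∀ i, Icc (e j.castSucc) (e j.succ) ⊆ Icc (lo i) (hi i) ↔ x ∈ Icc (lo i) (hi i) := by
  have hlo : ∀ i, ∃ a, e a = lo i := fun i => by
    have : lo i ∈ Set.range e := herange ▸ Or.inl ⟨i, rfl⟩
    exact this
  have hhi : ∀ i, ∃ a, e a = hi i := fun i => by
    have : hi i ∈ Set.range e := herange ▸ Or.inr ⟨i, rfl⟩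
    exact this
  by_cases hxh : ∃ i, hi i = x
  · obtain ⟨m, hm⟩ := hxh
    have hxl : ∀ i, lo i ≠ x := fun i => hm ▸ hne i m
    obtain ⟨n, hn⟩ := hhi m
    obtain ⟨a₀, ha₀⟩ := hlo i₀
    have h0 : a₀ < n := by
      rw [← hemono.lt_iff_lt, ha₀, hn, hm]
      exact lt_of_le_of_ne hx.1 (hxl i₀)
    obtain ⟨j, rfl⟩ := Fin.exists_succ_eq.2 (Fin.ne_zero_of_lt h0)
    have hxj : e j.succ = x := hn.trans hm
    have hlt : e j.castSucc < x := hxj ▸ hemono Fin.castSucc_lt_succ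
    refine ⟨j, ⟨hlt.le, hxj.ge⟩, fun i => ⟨fun H => H ⟨hlt.le, hxj.ge⟩, fun H => ?_⟩⟩
    obtain ⟨a, ha⟩ := hlo i
    have haj : a < j.succ := by
      rw [← hemono.lt_iff_lt, ha, hxj]
      exact lt_of_le_of_ne H.1 (hxl i)
    refine Icc_subset_Icc ?_ (hxj.le.trans H.2)
    rw [← ha]
    exact hemono.monotone (Fin.le_castSucc_iff.2 haj)
  · push Not at hxh
    obtain ⟨a₀, ha₀⟩ := hlo i₀
    obtain ⟨b₀, hb₀⟩ := hhi i₀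
    obtain ⟨n, hn, hmax⟩ := (Finset.univ.filter fun a => e a ≤ x).exists_max_image id
      ⟨a₀, by simpa [ha₀] using hx.1⟩
    simp only [Finset.mem_filter, Finset.mem_univ, true_and, id] at hn hmax
    have hnb : n < b₀ := by
      rw [← hemono.lt_iff_lt, hb₀]
      exact hn.trans_lt (lt_of_le_of_ne hx.2 (hxh i₀).symm)
    obtain ⟨j, rfl⟩ := Fin.exists_castSucc_eq.2 (Fin.ne_last_of_lt hnb)
    have hlt : x < e j.succ := by
      by_contra! H
      exact (hmax _ H).not_gt Fin.castSucc_lt_succ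
    refine ⟨j, ⟨hn, hlt.le⟩, fun i => ⟨fun H => H ⟨hn, hlt.le⟩, fun H => ?_⟩⟩
    obtain ⟨a, ha⟩ := hlo i
    obtain ⟨b, hb⟩ := hhi i
    have hjb : j.castSucc < b := by
      rw [← hemono.lt_iff_lt, hb]
      exact hn.trans_lt (lt_of_le_of_ne H.2 (hxh i).symm)
    refine Icc_subset_Icc ?_ ?_
    · rw [← ha]
      exact hemono.monotone (hmax a (ha.trans_le H.1))
    · rw [← hb]
      exact hemono.monotone (Fin.castSucc_lt_iff_succ_le.1 hjb)

/-- Weak duality for a probability measure in the ambiguity set. -/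
lemma dual_objective_nonneg_of_mem_ambSet {D : ℕ} {lo hi ql qh k h : Fin D → ℝ} {γ : ℝ}
    (hk : ∀ i, 0 ≤ k i) (hh : ∀ i, 0 ≤ h i) {i₀ : Fin D} (hql : ql i₀ = 1)
    (hf : ∀ x ∈ Icc (lo i₀) (hi i₀),
      0 ≤ ∑ i, (Icc (lo i) (hi i)).indicator (fun _ => k i - h i) x + γ * x)
    {Q : Measure ℝ} (hQ : Q ∈ ambSet D lo hi ql qh) :
    0 ≤ (∑ i, (qh i * k i - ql i * h i)) + (∫ x, x ∂Q) * γ := by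
  obtain ⟨hprob, hq⟩ := hQ
  have hae : ∀ᵐ x ∂Q, x ∈ Icc (lo i₀) (hi i₀) := by
    refine (mem_ae_iff_prob_eq_one measurableSet_Icc).2 (le_antisymm prob_le_one ?_)
    have h1 := (hq i₀).1
    rw [hql] at h1
    simpa using (ENNReal.ofReal_le_iff_le_toReal (measure_ne_top Q _)).2 h1
  have hint : Integrable (fun x : ℝ => x) Q :=
    Integrable.of_mem_Icc _ _ measurable_id.aemeasurable hae
  have hind : ∀ i, Integrable ((Icc (lo i) (hi i)).indicator (fun _ => k i - h i)) Q :=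
    fun i => (integrable_const _).indicator measurableSet_Icc
  have hnn := integral_nonneg_of_ae (hae.mono hf)
  rw [integral_add (integrable_finsetSum _ fun i _ => hind i) (hint.const_mul γ),
    integral_finsetSum _ fun i _ => hind i, integral_const_mul] at hnn
  have hsum : ∑ i, ∫ x, (Icc (lo i) (hi i)).indicator (fun _ => k i - h i) x ∂Q
      ≤ ∑ i, (qh i * k i - ql i * h i) := by
    refine Finset.sum_le_sum fun i _ => ?_
    rw [integral_indicator_const _ measurableSet_Icc, smul_eq_mul, measureReal_def]
    nlinarith [mul_le_mul_of_nonneg_right (hq i).2 (hk i),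
      mul_le_mul_of_nonneg_right (hq i).1 (hh i)]
  linarith

/-- An affine function that is nonnegative on a nonempty set of reals is nonnegative between the
infimum and the supremum of the set. -/
lemma affine_nonneg_of_mem_Icc_csInf_csSup {s : Set ℝ} (hs : s.Nonempty) {b γ c : ℝ}
    (hb : ∀ m ∈ s, 0 ≤ b + m * γ) (hc : c ∈ Icc (sInf s) (sSup s)) : 0 ≤ b + c * γ := by
  rcases lt_trichotomy γ 0 with hγ | rfl | hγ
  · have : sSup s ≤ b / -γ := csSup_le hs fun m hm => by
      rw [le_div_iff₀ (neg_pos.2 hγ)]; linarith [hb m hm]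
    have := (le_div_iff₀ (neg_pos.2 hγ)).1 (hc.2.trans this)
    linarith
  · obtain ⟨m, hm⟩ := hs
    simpa using hb m hm
  · have : -b / γ ≤ sInf s := le_csInf hs fun m hm => by
      rw [div_le_iff₀ hγ]; linarith [hb m hm]
    have := (div_le_iff₀ hγ).1 (this.trans hc.1)
    linarith

/-- Under Assumptions A1 and A2, for `c̄ ∈ [c^min, c^max]` every feasible solution of the dual
problem (with variables `k, h ≥ 0` and `γ ∈ ℝ` satisfying
`∑_{i ∈ D(j)} (k_i − h_i) + min{γ L_j, γ U_j} ≥ 0` for every `j`) has nonnegative objective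
value `∑_i (q̄_i k_i − q̲_i h_i) + c̄ γ ≥ 0`. -/
theorem stmt_13 (D W : ℕ) (hD : 0 < D)
    (l u : ℝ) (hl0 : 0 ≤ l) (hlu : l ≤ u)
    (lo hi ql qh : Fin D → ℝ)
    (hllo : ∀ i, l ≤ lo i) (hlohi : ∀ i, lo i ≤ hi i) (hhiu : ∀ i, hi i ≤ u)
    (hql0 : ∀ i, 0 ≤ ql i) (hqlqh : ∀ i, ql i ≤ qh i) (hqh1 : ∀ i, qh i ≤ 1)
    (hloD : lo ⟨D - 1, Nat.sub_lt hD one_pos⟩ = l)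
    (hhiD : hi ⟨D - 1, Nat.sub_lt hD one_pos⟩ = u)
    (hqlD : ql ⟨D - 1, Nat.sub_lt hD one_pos⟩ = 1)
    (hqhD : qh ⟨D - 1, Nat.sub_lt hD one_pos⟩ = 1)
    (e : Fin (W + 1) → ℝ) (hemono : StrictMono e)
    (herange : Set.range e = Set.range lo ∪ Set.range hi)
    (hA1 : ∃ Q ∈ ambSet D lo hi ql qh, ∀ i : Fin D, ql i < qh i →
      ql i < (Q (Icc (lo i) (hi i))).toReal ∧ (Q (Icc (lo i) (hi i))).toReal < qh i)
    (hA2 : ∀ i₁ i₂ : Fin D, lo i₁ ≠ hi i₂)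
    (cbar : ℝ)
    (hcbar : cbar ∈ Icc (sInf (meanSet D lo hi ql qh)) (sSup (meanSet D lo hi ql qh)))
    (k h : Fin D → ℝ) (γ : ℝ)
    (hk : ∀ i, 0 ≤ k i) (hh : ∀ i, 0 ≤ h i)
    (hfeas : ∀ j : Fin W,
      0 ≤ (∑ i ∈ Finset.univ.filter
          (fun i : Fin D => Icc (e j.castSucc) (e j.succ) ⊆ Icc (lo i) (hi i)), (k i - h i))
        + min (γ * e j.castSucc) (γ * e j.succ)) :
    0 ≤ (∑ i, (qh i * k i - ql i * h i)) + cbar * γ := by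
  obtain ⟨Q₀, hQ₀, -⟩ := hA1
  refine affine_nonneg_of_mem_Icc_csInf_csSup
    (s := meanSet D lo hi ql qh) (Set.Nonempty.image _ ⟨Q₀, hQ₀⟩) ?_ hcbar
  rintro _ ⟨Q, hQ, rfl⟩
  refine dual_objective_nonneg_of_mem_ambSet hk hh hqlD (fun x hx => ?_) hQ
  obtain ⟨j, hxj, hj⟩ := exists_elementary_interval hemono herange hA2 _ hx
  have hmin : min (γ * e j.castSucc) (γ * e j.succ) ≤ γ * x := by
    rcases le_total 0 γ with hγ | hγ
    · exact (min_le_left _ _).trans (mul_le_mul_of_nonneg_left hxj.1 hγ)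
    · exact (min_le_right _ _).trans (mul_le_mul_of_nonpos_left hxj.2 hγ)
  have hfj := hfeas j
  simp only [hj, Finset.sum_filter] at hfj
  simp only [Set.indicator_apply]
  linarith
end
end
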